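/- Universal code for i.i.d. channels: for any test channel V ∈ 𝒱(E,D) and any δ > 0, there exist a code (φ_n, ψ_n) and μ > 0 such that (1/n)log|ℳ_n| ≤ max_{W ∈ 𝒲₁(E)} φ(V,W) + 2δ and Pr{ d_n(X^n, ψ_n(φ_n(X^n), Y^n)) > D + δ } ≤ 2^{−μn} for every W ∈ 𝒲₁(E) ∩ 𝒫_n(𝒴|𝒳), where Y^n is the output of the i.i.d. channel W^{×n} on input X^n, provided n is sufficiently large. -/

import Mathlib

open scoped BigOperators

noncomputable section

namespace UWZ

/-- real-valued indicator of a proposition. -/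
def ind (p : Prop) : ℝ := @ite ℝ p (Classical.propDecidable p) 1 0

/-- `P` is a probability distribution on the finite type `A`. -/
def IsDist {A : Type*} [Fintype A] (P : A → ℝ) : Prop :=
  (∀ a, 0 ≤ P a) ∧ ∑ a, P a = 1

/-- `W` is a channel from `A` to `B`. -/
def IsChannel {A B : Type*} [Fintype A] [Fintype B] (W : A → B → ℝ) : Prop :=
  ∀ a, IsDist (W a)

/-- the `n`-fold i.i.d. extension of `P`. -/
def iid {A : Type*} (P : A → ℝ) (n : ℕ) (xs : Fin n → A) : ℝ := ∏ t, P (xs t)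

/-- the memoryless (`n`-fold i.i.d.) extension of a channel. -/
def memoryless {A B : Type*} (W : A → B → ℝ) (n : ℕ)
    (xs : Fin n → A) (ys : Fin n → B) : ℝ :=
  ∏ t, W (xs t) (ys t)

/-- the additive (per-letter, normalized) extension of a distortion measure. -/
def dseq {A B : Type*} (d : A → B → ℝ) (n : ℕ) (xs : Fin n → A) (ys : Fin n → B) : ℝ :=
  (∑ t, d (xs t) (ys t)) / n

/-- Shannon entropy (in bits). -/
def ent {A : Type*} [Fintype A] (P : A → ℝ) : ℝ := -∑ a, P a * Real.logb 2 (P a)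

/-- mutual information of a joint distribution on `A × B` (in bits). -/
def mutInf {A B : Type*} [Fintype A] [Fintype B] (J : A × B → ℝ) : ℝ :=
  ent (fun a => ∑ b, J (a, b)) + ent (fun b => ∑ a, J (a, b)) - ent J

section WZ

variable {X Y Xh : Type*} [Fintype X] [Fintype Y] [Fintype Xh] [DecidableEq Y]

/-- expected per-letter side-information distortion `e(P,W)` of channel `W`. -/
def eDist (P : X → ℝ) (e : X → Y → ℝ) (W : X → Y → ℝ) : ℝ :=
  ∑ x, ∑ y, P x * W x y * e x y

/-- the class `𝒲₁(E)` of single-letter channels. -/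
def W1 (P : X → ℝ) (e : X → Y → ℝ) (E : ℝ) : Set (X → Y → ℝ) :=
  {W | IsChannel W ∧ eDist P e W ≤ E}

/-- `d(V,W)`: expected reproduction distortion for a test channel `V` whose output
alphabet `𝒰` is the set of functions from `Y` to `Xh`. -/
def dVW (P : X → ℝ) (d : X → Xh → ℝ) (V : X → (Y → Xh) → ℝ) (W : X → Y → ℝ) : ℝ :=
  ∑ u : Y → Xh, ∑ x, ∑ y, P x * V x u * W x y * d x (u y)

/-- `φ(V,W) = I(U;X) − I(U;Y)` under the joint law `P_X(x)V(u|x)W(y|x)`. -/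
def phi (P : X → ℝ) (V : X → (Y → Xh) → ℝ) (W : X → Y → ℝ) : ℝ :=
  mutInf (fun p : (Y → Xh) × X => P p.2 * V p.2 p.1) -
    mutInf (fun p : (Y → Xh) × Y => ∑ x, P x * V x p.1 * W x p.2)

/-- `𝒱(W,D)`. -/
def Vset (P : X → ℝ) (d : X → Xh → ℝ) (W : X → Y → ℝ) (D : ℝ) :
    Set (X → (Y → Xh) → ℝ) :=
  {V | IsChannel V ∧ dVW P d V W ≤ D}

/-- `𝒱(E,D)`. -/
def Vrob (P : X → ℝ) (e : X → Y → ℝ) (d : X → Xh → ℝ) (E D : ℝ) :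
    Set (X → (Y → Xh) → ℝ) :=
  {V | IsChannel V ∧ ∀ W ∈ W1 P e E, dVW P d V W ≤ D}

/-- the Wyner–Ziv rate-distortion function `R_WZ(D|W)`. -/
def RWZ (P : X → ℝ) (d : X → Xh → ℝ) (D : ℝ) (W : X → Y → ℝ) : ℝ :=
  sInf ((fun V => phi P V W) '' Vset P d W D)

/-- the pseudo rate-distortion function `R̃_WZ(D|W,E)`. -/
def RWZt (P : X → ℝ) (e : X → Y → ℝ) (d : X → Xh → ℝ) (D E : ℝ) (W : X → Y → ℝ) : ℝ :=
  sInf ((fun V => phi P V W) '' Vrob P e d E D)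

end WZ

/-- a (possibly stochastic) Wyner–Ziv code of blocklength `n`:
a stochastic encoder `enc : 𝒳ⁿ → ℳ` and a decoder `dec : ℳ × 𝒴ⁿ → 𝒳̂ⁿ`. -/
structure Code (X Y Xh : Type*) [Fintype X] (n : ℕ) where
  M : ℕ
  Mpos : 0 < M
  enc : (Fin n → X) → Fin M → ℝ
  enc_channel : IsChannel enc
  dec : Fin M → (Fin n → Y) → Fin n → Xh

section Codes

variable {X Y Xh : Type*} [Fintype X] [Fintype Y] [Fintype Xh]

/-- expected reproduction distortion of a code over the channel `Wn`. -/
def Code.expDist {n : ℕ} (C : Code X Y Xh n) (P : X → ℝ) (d : X → Xh → ℝ)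
    (Wn : (Fin n → X) → (Fin n → Y) → ℝ) : ℝ :=
  ∑ xs, ∑ ys, ∑ m, iid P n xs * Wn xs ys * C.enc xs m * dseq d n xs (C.dec m ys)

/-- probability that the reproduction distortion of a code exceeds `D`, over channel `Wn`. -/
def Code.excessProb {n : ℕ} (C : Code X Y Xh n) (P : X → ℝ) (d : X → Xh → ℝ)
    (Wn : (Fin n → X) → (Fin n → Y) → ℝ) (D : ℝ) : ℝ :=
  ∑ xs, ∑ ys, ∑ m, iid P n xs * Wn xs ys * C.enc xs m * ind (D < dseq d n xs (C.dec m ys))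

/-- a sequence of channels from `X`-sequences to `Y`-sequences. -/
abbrev ChannelSeq (X Y : Type*) := ∀ n : ℕ, (Fin n → X) → (Fin n → Y) → ℝ

/-- probability that the side-information distortion exceeds `E`. -/
def excessSideProb (P : X → ℝ) (e : X → Y → ℝ) {n : ℕ}
    (Wn : (Fin n → X) → (Fin n → Y) → ℝ) (E : ℝ) : ℝ :=
  ∑ xs, ∑ ys, iid P n xs * Wn xs ys * ind (E < dseq e n xs ys)

/-- expected side-information distortion at blocklength `n`. -/
def avgSideDist (P : X → ℝ) (e : X → Y → ℝ) {n : ℕ}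
    (Wn : (Fin n → X) → (Fin n → Y) → ℝ) : ℝ :=
  ∑ xs, ∑ ys, iid P n xs * Wn xs ys * dseq e n xs ys

/-- the maximum distortion constrained class `𝒲_m(E)`. -/
def MaxClass (P : X → ℝ) (e : X → Y → ℝ) (E : ℝ) : Set (ChannelSeq X Y) :=
  {Wseq | (∀ n, IsChannel (Wseq n)) ∧
    ∀ δ > (0:ℝ), ∃ n0 : ℕ, ∀ n ≥ n0, excessSideProb P e (Wseq n) E ≤ δ}

/-- the average distortion constrained class `𝒲_a(E)`. -/
def AvgClass (P : X → ℝ) (e : X → Y → ℝ) (E : ℝ) : Set (ChannelSeq X Y) :=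
  {Wseq | (∀ n, IsChannel (Wseq n)) ∧ ∀ n, 1 ≤ n → avgSideDist P e (Wseq n) ≤ E}

/-- `R` is an achievable rate at distortion level `D`, universally for the class `WC`
of channel sequences. -/
def Achievable (P : X → ℝ) (d : X → Xh → ℝ) (WC : Set (ChannelSeq X Y)) (D R : ℝ) : Prop :=
  ∀ ε > (0:ℝ), ∃ n0 : ℕ, ∃ C : ∀ n, Code X Y Xh n, ∀ n ≥ n0,
    Real.logb 2 ((C n).M : ℝ) / (n : ℝ) ≤ R + ε ∧
    ∀ Wseq ∈ WC, (C n).expDist P d (Wseq n) ≤ D + ε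

/-- the rate-distortion function `R_m(D|E)` of the maximum distortion constrained class. -/
def Rm (P : X → ℝ) (e : X → Y → ℝ) (d : X → Xh → ℝ) (D E : ℝ) : ℝ :=
  sInf {R | Achievable P d (MaxClass P e E) D R}

/-- the rate-distortion function `R_a(D|E)` of the average distortion constrained class. -/
def Ra (P : X → ℝ) (e : X → Y → ℝ) (d : X → Xh → ℝ) (D E : ℝ) : ℝ :=
  sInf {R | Achievable P d (AvgClass P e E) D R}

end Codes

/-- a Heegard–Berger code: one encoder and two decoders. -/
structure HBCode (X Y Xh : Type*) (n : ℕ) where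
  M : ℕ
  Mpos : 0 < M
  enc : (Fin n → X) → Fin M
  dec1 : Fin M → (Fin n → Y) → Fin n → Xh
  dec2 : Fin M → (Fin n → Y) → Fin n → Xh

section HB

variable {X Y Xh : Type*} [Fintype X] [Fintype Y] [Fintype Xh]

/-- expected distortion of one branch of a Heegard–Berger code over the memoryless
extension of the single-letter channel `W`. -/
def hbExpDist {n M : ℕ} (P : X → ℝ) (d : X → Xh → ℝ) (W : X → Y → ℝ)
    (enc : (Fin n → X) → Fin M) (dec : Fin M → (Fin n → Y) → Fin n → Xh) : ℝ :=
  ∑ xs, ∑ ys, iid P n xs * memoryless W n xs ys * dseq d n xs (dec (enc xs) ys)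

/-- achievability for the Heegard–Berger problem with side-information channels `W₁, W₂`. -/
def HBAchievable (P : X → ℝ) (d : X → Xh → ℝ) (W₁ W₂ : X → Y → ℝ) (D₁ D₂ R : ℝ) : Prop :=
  ∀ ε > (0:ℝ), ∃ n0 : ℕ, ∃ C : ∀ n, HBCode X Y Xh n, ∀ n ≥ n0,
    Real.logb 2 ((C n).M : ℝ) / (n : ℝ) ≤ R + ε ∧
    hbExpDist P d W₁ (C n).enc (C n).dec1 ≤ D₁ + ε ∧
    hbExpDist P d W₂ (C n).enc (C n).dec2 ≤ D₂ + ε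

/-- the Heegard–Berger rate-distortion function `R_HB(D₁,D₂|W₁,W₂)`. -/
def RHB (P : X → ℝ) (d : X → Xh → ℝ) (W₁ W₂ : X → Y → ℝ) (D₁ D₂ : ℝ) : ℝ :=
  sInf {R | HBAchievable P d W₁ W₂ D₁ D₂ R}

end HB

/-- the classical (no side-information) rate-distortion function `R(D)`. -/
def RD {X Xh : Type*} [Fintype X] [Fintype Xh] (P : X → ℝ) (d : X → Xh → ℝ) (D : ℝ) : ℝ :=
  sInf ((fun Q : X → Xh → ℝ => mutInf fun p : X × Xh => P p.1 * Q p.1 p.2) ''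
    {Q | IsChannel Q ∧ (∑ x, ∑ xh, P x * Q x xh * d x xh) ≤ D})

section Types

variable {X Y : Type*} [Fintype X] [Fintype Y] [DecidableEq X] [DecidableEq Y]

/-- the empirical distribution (type) `P_{x^n}` of a sequence. -/
def empDist {n : ℕ} (xs : Fin n → X) (a : X) : ℝ :=
  ((Finset.univ.filter fun t => xs t = a).card : ℝ) / n

/-- the joint empirical distribution (joint type) of a pair of sequences. -/
def empJoint {n : ℕ} (xs : Fin n → X) (ys : Fin n → Y) (p : X × Y) : ℝ :=
  ((Finset.univ.filter fun t => xs t = p.1 ∧ ys t = p.2).card : ℝ) / n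

/-- `x^n` is `P`-typical with constant `δ`. -/
def isTypical {n : ℕ} (P : X → ℝ) (δ : ℝ) (xs : Fin n → X) : Prop :=
  (∀ a, |empDist xs a - P a| ≤ δ) ∧ ∀ t, P (xs t) ≠ 0

/-- `y^n` lies in the `W`-shell `T_W(x^n)` of `x^n`. -/
def inShell {n : ℕ} (xs : Fin n → X) (ys : Fin n → Y) (W : X → Y → ℝ) : Prop :=
  ∀ a b, empJoint xs ys (a, b) = empDist xs a * W a b

/-- cardinality of the `W`-shell of `x^n`. -/
def shellCard {n : ℕ} (xs : Fin n → X) (W : X → Y → ℝ) : ℕ :=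
  Set.ncard {ys : Fin n → Y | inShell xs ys W}

end Types

/-- `W` is a conditional type with denominator `n` (all entries are multiples of `1/n`). -/
def isCondType {X Y : Type*} (n : ℕ) (W : X → Y → ℝ) : Prop :=
  ∀ x y, ∃ k : ℕ, W x y = (k : ℝ) / n

section Perm

variable {X Y Xh : Type*} [Fintype X] [Fintype Y] [Fintype Xh]

/-- probability, under the permuted source/side-information pair, that the reproduction
distortion of the code `C` exceeds `D`. -/
def permExcess {n : ℕ} (Pxy : (Fin n → X) × (Fin n → Y) → ℝ) (C : Code X Y Xh n)
    (d : X → Xh → ℝ) (D : ℝ) (π : Equiv.Perm (Fin n)) : ℝ :=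
  ∑ p : (Fin n → X) × (Fin n → Y), ∑ m,
    Pxy p * C.enc (p.1 ∘ π) m * ind (D < dseq d n (p.1 ∘ π) (C.dec m (p.2 ∘ π)))

end Perm


/-! ### helper lemmas -/

lemma ind_nonneg (p : Prop) : 0 ≤ ind p := by unfold ind; split_ifs <;> norm_num

lemma ind_le_one (p : Prop) : ind p ≤ 1 := by unfold ind; split_ifs <;> norm_num

lemma ind_true {p : Prop} (h : p) : ind p = 1 := by unfold ind; rw [if_pos h]

lemma ind_false {p : Prop} (h : ¬ p) : ind p = 0 := by unfold ind; rw [if_neg h]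

lemma ind_mono {p q : Prop} (h : p → q) : ind p ≤ ind q := by
  by_cases hp : p
  · rw [ind_true hp, ind_true (h hp)]
  · rw [ind_false hp]; exact ind_nonneg _

lemma ind_or (p q : Prop) : ind (p ∨ q) ≤ ind p + ind q := by
  by_cases hp : p
  · rw [ind_true hp, ind_true (Or.inl hp)]; linarith [ind_nonneg q]
  · by_cases hq : q
    · rw [ind_true hq, ind_true (Or.inr hq)]; linarith [ind_nonneg p]
    · rw [ind_false (by tauto)]; linarith [ind_nonneg p, ind_nonneg q]

/-- expectation of a product over a random codebook. -/
lemma exp_prod {I U : Type*} [Fintype I] [DecidableEq I] [Fintype U] (p : U → ℝ) (h : I → U → ℝ) :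
    ∑ c : I → U, (∏ i, p (c i)) * ∏ i, h i (c i) = ∏ i, ∑ u, p u * h i u := by
  rw [Finset.prod_univ_sum, Fintype.piFinset_univ]
  refine Finset.sum_congr rfl fun c _ => ?_
  rw [Finset.prod_mul_distrib]

lemma exp_one {I U : Type*} [Fintype I] [DecidableEq I] [Fintype U] (p : U → ℝ)
    (hp : ∑ u, p u = 1) : ∑ c : I → U, (∏ i, p (c i)) = 1 := by
  have := exp_prod (I := I) p (fun _ _ => 1)
  simpa [hp] using this

lemma exp_single {I U : Type*} [Fintype I] [DecidableEq I] [Fintype U] (p : U → ℝ)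
    (hp : ∑ u, p u = 1) (f : U → ℝ) (i : I) :
    ∑ c : I → U, (∏ l, p (c l)) * f (c i) = ∑ u, p u * f u := by
  have := exp_prod (I := I) p (fun l u => if l = i then f u else 1)
  have e1 : ∀ c : I → U, (∏ l, if l = i then f (c l) else 1) = f (c i) := fun c => by
    simp
  have e2 : (∏ l, ∑ u, p u * (if l = i then f u else 1)) = ∑ u, p u * f u := by
    rw [Finset.prod_eq_single i]
    · simp
    · intro b _ hb; simp [hb, hp]
    · simp
  simp only [e1, e2] at this
  exact this

lemma exp_pair {I U : Type*} [Fintype I] [DecidableEq I] [Fintype U] (p : U → ℝ)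
    (hp : ∑ u, p u = 1) (f g : U → ℝ) (i j : I) (hij : i ≠ j) :
    ∑ c : I → U, (∏ l, p (c l)) * (f (c i) * g (c j)) = (∑ u, p u * f u) * (∑ u, p u * g u) := by
  have := exp_prod (I := I) p (fun l u => (if l = i then f u else 1) * (if l = j then g u else 1))
  have e1 : ∀ c : I → U, (∏ l, (if l = i then f (c l) else 1) * (if l = j then g (c l) else 1))
      = f (c i) * g (c j) := fun c => by
    rw [Finset.prod_mul_distrib]; simp
  have e2 : (∏ l, ∑ u, p u * ((if l = i then f u else 1) * (if l = j then g u else 1)))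
      = (∑ u, p u * f u) * (∑ u, p u * g u) := by
    rw [Fintype.prod_eq_mul i j hij]
    · simp [hij, hij.symm]
    · rintro b ⟨hb, hb'⟩; simp [hb, hb', hp]
  simp only [e1, e2] at this
  exact this

/-- one-sided soft covering. -/
lemma cover {I U : Type*} [Fintype I] [DecidableEq I] [Nonempty I] [Fintype U] (p : U → ℝ)
    (hp : IsDist p) (r : U → ℝ) (hr : ∀ u, 0 ≤ r u) (hr1 : ∑ u, p u * r u = 1)
    (T θ : ℝ) (hT : 0 ≤ T) (hθ : 0 < θ) (hTθ : T ≤ θ ^ 2 * Fintype.card I) :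
    ∑ c : I → U, (∏ i, p (c i)) * max 0 (1 - (∑ i, r (c i)) / Fintype.card I)
      ≤ ∑ u, p u * r u * ind (T < r u) + θ := by
  set L : ℝ := (Fintype.card I : ℝ) with hL
  have hLpos : 0 < L := by rw [hL]; exact_mod_cast Fintype.card_pos
  set s : U → ℝ := fun u => r u * (1 - ind (T < r u)) with hs
  set b : ℝ := ∑ u, p u * r u * ind (T < r u) with hb
  set a : ℝ := ∑ u, p u * s u with ha
  have hab : a = 1 - b := by
    rw [ha, hb, ← hr1, ← Finset.sum_sub_distrib]
    refine Finset.sum_congr rfl fun u _ => ?_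
    simp only [hs]; ring
  have hs0 : ∀ u, 0 ≤ s u := fun u => mul_nonneg (hr u) (by linarith [ind_le_one (T < r u)])
  have hsr : ∀ u, s u ≤ r u := fun u => by
    simp only [hs]; nlinarith [hr u, ind_nonneg (T < r u)]
  have hsT : ∀ u, s u ≤ T := fun u => by
    by_cases h : T < r u
    · simp only [hs, ind_true h]; simpa using hT
    · simp only [hs, ind_false h]; linarith
  have hb0 : 0 ≤ b := Finset.sum_nonneg fun u _ =>
    mul_nonneg (mul_nonneg (hp.1 u) (hr u)) (ind_nonneg _)
  have ha1 : a ≤ 1 := by linarith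
  have hw : ∀ c : I → U, 0 ≤ ∏ i, p (c i) := fun c => Finset.prod_nonneg fun i _ => hp.1 _
  have hz : ∑ u, p u * (s u - a) = 0 := by
    have : ∑ u, p u * (s u - a) = a - (∑ u, p u) * a := by
      rw [Finset.sum_mul, ha, ← Finset.sum_sub_distrib]
      refine Finset.sum_congr rfl fun u _ => by ring
    rw [this, hp.2]; ring
  have hv : ∑ u, p u * ((s u - a) * (s u - a)) ≤ T := by
    have h1 : ∑ u, p u * ((s u - a) * (s u - a)) = ∑ u, p u * (s u * s u) - a * a := by
      have e : ∀ u, p u * ((s u - a) * (s u - a)) =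
        p u * (s u * s u) - 2 * a * (p u * s u) + a * a * p u := fun u => by ring
      simp only [e]
      rw [Finset.sum_add_distrib, Finset.sum_sub_distrib, ← Finset.mul_sum, ← Finset.mul_sum,
        ← ha, hp.2]; ring
    have h2 : ∑ u, p u * (s u * s u) ≤ T * a := by
      rw [ha, Finset.mul_sum]
      refine Finset.sum_le_sum fun u _ => ?_
      have := mul_le_mul_of_nonneg_left (hsT u) (mul_nonneg (hp.1 u) (hs0 u))
      nlinarith
    nlinarith [mul_self_nonneg a]
  have hvar : ∑ c : I → U, (∏ i, p (c i)) * (∑ i, (s (c i) - a)) ^ 2 ≤ L * T := by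
    have e : ∀ c : I → U, (∏ i, p (c i)) * (∑ i, (s (c i) - a)) ^ 2 =
        ∑ i, ∑ j, (∏ l, p (c l)) * ((s (c i) - a) * (s (c j) - a)) := fun c => by
      rw [sq, Finset.sum_mul_sum, Finset.mul_sum]
      refine Finset.sum_congr rfl fun i _ => ?_
      rw [Finset.mul_sum]
    simp only [e]
    rw [Finset.sum_comm]
    have : ∀ i : I, ∑ c : I → U, ∑ j, (∏ l, p (c l)) * ((s (c i) - a) * (s (c j) - a)) ≤ T := by
      intro i
      rw [Finset.sum_comm, Finset.sum_eq_single i]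
      · rw [exp_single p hp.2 (fun u => (s u - a) * (s u - a)) i]; exact hv
      · intro j _ hj
        rw [exp_pair p hp.2 (fun u => s u - a) (fun u => s u - a) i j hj.symm, hz]; ring
      · simp
    calc _ ≤ ∑ i : I, T := Finset.sum_le_sum fun i _ => this i
      _ = L * T := by simp [hL]
  have hpt : ∀ c : I → U, max 0 (1 - (∑ i, r (c i)) / L) ≤
      b + θ / 2 + (∑ i, (s (c i) - a)) ^ 2 * (1 / (2 * θ * L ^ 2)) := by
    intro c
    set Z := ∑ i, (s (c i) - a) with hZ
    have hZ' : Z = ∑ i, s (c i) - L * a := by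
      rw [hZ, Finset.sum_sub_distrib]; simp [hL]
    have h1 : ∑ i, s (c i) ≤ ∑ i, r (c i) := Finset.sum_le_sum fun i _ => hsr _
    have key : -(Z / L) ≤ θ / 2 + Z ^ 2 * (1 / (2 * θ * L ^ 2)) := by
      have e : Z ^ 2 * (1 / (2 * θ * L ^ 2)) = (Z / L) ^ 2 / (2 * θ) := by field_simp
      rw [e]
      have : θ / 2 + (Z / L) ^ 2 / (2 * θ) + Z / L = (θ + Z / L) ^ 2 / (2 * θ) := by
        field_simp; ring
      have h3 : 0 ≤ (θ + Z / L) ^ 2 / (2 * θ) := by positivity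
      linarith
    apply max_le
    · positivity
    · have : (∑ i, s (c i)) / L ≤ (∑ i, r (c i)) / L := by gcongr
      have e2 : (∑ i, s (c i)) / L = Z / L + a := by
        rw [hZ']; field_simp; ring
      linarith
  calc _ ≤ ∑ c : I → U, (∏ i, p (c i)) *
        (b + θ / 2 + (∑ i, (s (c i) - a)) ^ 2 * (1 / (2 * θ * L ^ 2))) :=
        Finset.sum_le_sum fun c _ => mul_le_mul_of_nonneg_left (hpt c) (hw c)
    _ = (b + θ / 2) + (∑ c : I → U, (∏ i, p (c i)) * (∑ i, (s (c i) - a)) ^ 2) *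
        (1 / (2 * θ * L ^ 2)) := by
        simp only [mul_add, Finset.sum_add_distrib, ← Finset.sum_mul, exp_one p hp.2, one_mul,
          ← mul_assoc]
    _ ≤ (b + θ / 2) + (L * T) * (1 / (2 * θ * L ^ 2)) := by gcongr
    _ ≤ b + θ := by
        have : (L * T) * (1 / (2 * θ * L ^ 2)) ≤ (L * (θ ^ 2 * L)) * (1 / (2 * θ * L ^ 2)) := by
          gcongr
        have e : (L * (θ ^ 2 * L)) * (1 / (2 * θ * L ^ 2)) = θ / 2 := by field_simp
        linarith

/-- the likelihood encoder. -/
def lenc {U X : Type*} {M K : ℕ} (r : U → X → ℝ) (c : Fin M × Fin K → U) (x : X) (m : Fin M) : ℝ :=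
  @ite ℝ (∑ i, r (c i) x = 0) (Classical.propDecidable _) (1 / M)
    ((∑ k, r (c (m, k)) x) / ∑ i, r (c i) x)

lemma lenc_channel {U X : Type*} [Fintype X] {M K : ℕ} (hM : 0 < M) (r : U → X → ℝ)
    (hr : ∀ u x, 0 ≤ r u x) (c : Fin M × Fin K → U) : IsChannel (lenc r c) := by
  have hM' : (0:ℝ) < M := by exact_mod_cast hM
  intro x
  by_cases h : ∑ i, r (c i) x = 0
  · have e : ∀ m, lenc r c x m = 1 / M := fun m => by unfold lenc; rw [if_pos h]
    refine ⟨fun m => by rw [e]; positivity, ?_⟩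
    simp only [e]; simp; field_simp
  · have e : ∀ m, lenc r c x m = (∑ k, r (c (m, k)) x) / ∑ i, r (c i) x :=
      fun m => by unfold lenc; rw [if_neg h]
    refine ⟨fun m => by
      rw [e]; exact div_nonneg (Finset.sum_nonneg fun _ _ => hr _ _)
        (Finset.sum_nonneg fun _ _ => hr _ _), ?_⟩
    simp only [e]
    rw [← Finset.sum_div, ← Fintype.sum_prod_type (fun i => r (c i) x), div_self h]

lemma lenc_le {U X : Type*} [Fintype X] {M K : ℕ} (hM : 0 < M) (hK : 0 < K) (r : U → X → ℝ)
    (hr : ∀ u x, 0 ≤ r u x) (c : Fin M × Fin K → U) (x : X) (m : Fin M) :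
    lenc r c x m ≤ (∑ k, r (c (m, k)) x) / ((M : ℝ) * K) +
      lenc r c x m * max 0 (1 - (∑ i, r (c i) x) / ((M : ℝ) * K)) := by
  have hM' : (0:ℝ) < M := by exact_mod_cast hM
  have hK' : (0:ℝ) < K := by exact_mod_cast hK
  have hn := (lenc_channel hM r hr c x).1 m
  have h2 : lenc r c x m * ((∑ i, r (c i) x) / ((M : ℝ) * K)) ≤
      (∑ k, r (c (m, k)) x) / ((M : ℝ) * K) := by
    by_cases h : ∑ i, r (c i) x = 0
    · rw [h]; simp
      exact div_nonneg (Finset.sum_nonneg fun _ _ => hr _ _) (by positivity)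
    · have e : lenc r c x m = (∑ k, r (c (m, k)) x) / ∑ i, r (c i) x := by
        unfold lenc; rw [if_neg h]
      rw [e]; apply le_of_eq; field_simp
  have h1 := mul_le_mul_of_nonneg_left
    (le_max_right 0 (1 - (∑ i, r (c i) x) / ((M : ℝ) * K))) hn
  nlinarith

open Classical in
/-- the decoder. -/
def ldec {U Y : Type*} {M K : ℕ} (hK : 0 < K) (pass : U → Y → Prop) (c : Fin M × Fin K → U)
    (m : Fin M) (y : Y) : U :=
  if h : ∃ k, pass (c (m, k)) y then c (m, h.choose) else c (m, ⟨0, hK⟩)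

lemma ldec_bad {U X Y : Type*} {M K : ℕ} (hK : 0 < K) (pass : U → Y → Prop)
    (bad : X → Y → U → Prop) (c : Fin M × Fin K → U) (m : Fin M) (k : Fin K) (x : X) (y : Y) :
    ind (bad x y (ldec hK pass c m y)) ≤ ind (¬ pass (c (m, k)) y ∨ bad x y (c (m, k))) +
      ∑ k' ∈ Finset.univ.erase k, ind (pass (c (m, k')) y) := by
  have hs : 0 ≤ ∑ k' ∈ Finset.univ.erase k, ind (pass (c (m, k')) y) :=
    Finset.sum_nonneg fun _ _ => ind_nonneg _
  by_cases h1 : ¬ pass (c (m, k)) y ∨ bad x y (c (m, k))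
  · rw [ind_true h1]; linarith [ind_le_one (bad x y (ldec hK pass c m y))]
  · by_cases h2 : ∃ k' ∈ Finset.univ.erase k, pass (c (m, k')) y
    · obtain ⟨k', hk', hp⟩ := h2
      have := Finset.single_le_sum (f := fun k' => ind (pass (c (m, k')) y))
        (fun _ _ => ind_nonneg _) hk'
      simp only [ind_true hp] at this
      linarith [ind_le_one (bad x y (ldec hK pass c m y)), ind_nonneg (¬ pass (c (m, k)) y ∨ bad x y (c (m, k)))]
    · push Not at h1 h2
      have hex : ∃ k, pass (c (m, k)) y := ⟨k, h1.1⟩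
      have : ldec hK pass c m y = c (m, k) := by
        unfold ldec; rw [dif_pos hex]
        by_contra hne
        refine h2 hex.choose (Finset.mem_erase.2 ⟨fun h => hne (by rw [h]), Finset.mem_univ _⟩)
          hex.choose_spec
      rw [this, ind_false h1.2]
      linarith [ind_nonneg (¬ pass (c (m, k)) y ∨ bad x y (c (m, k)))]

lemma err_le {U X Y : Type*} [Fintype X] [Fintype Y] {M K : ℕ} (hM : 0 < M) (hK : 0 < K)
    (P : X → ℝ) (hP : ∀ x, 0 ≤ P x) (r : U → X → ℝ)
    (hr : ∀ u x, 0 ≤ r u x) (W : X → Y → ℝ) (hW : IsChannel W) (pass : U → Y → Prop)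
    (bad : X → Y → U → Prop) (c : Fin M × Fin K → U) :
    ∑ x, ∑ y, ∑ m, P x * W x y * lenc r c x m * ind (bad x y (ldec hK pass c m y)) ≤
      (∑ i : Fin M × Fin K, ∑ x, ∑ y, P x * W x y *
        (r (c i) x * ind (¬ pass (c i) y ∨ bad x y (c i)) +
          ∑ k' ∈ Finset.univ.erase i.2, r (c i) x * ind (pass (c (i.1, k')) y))) / ((M : ℝ) * K)
      + ∑ x, P x * max 0 (1 - (∑ i, r (c i) x) / ((M : ℝ) * K)) := by
  have hM' : (0:ℝ) < M := by exact_mod_cast hM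
  have hK' : (0:ℝ) < K := by exact_mod_cast hK
  have hch := lenc_channel hM r hr c
  rw [Finset.sum_comm (s := (Finset.univ : Finset (Fin M × Fin K))), Finset.sum_div,
    ← Finset.sum_add_distrib]
  refine Finset.sum_le_sum fun x _ => ?_
  set Z := max 0 (1 - (∑ i, r (c i) x) / ((M : ℝ) * K)) with hZ
  have hZ0 : 0 ≤ Z := le_max_left _ _
  have e1 : P x * Z = ∑ y, ∑ m, P x * W x y * (lenc r c x m * Z) := by
    have : ∀ y, ∑ m, P x * W x y * (lenc r c x m * Z) = P x * Z * W x y := fun y => by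
      rw [← Finset.mul_sum, ← Finset.sum_mul, (hch x).2]; ring
    simp only [this]
    rw [← Finset.mul_sum, (hW x).2, mul_one]
  rw [e1, Finset.sum_comm (s := (Finset.univ : Finset (Fin M × Fin K))), Finset.sum_div,
    ← Finset.sum_add_distrib]
  refine Finset.sum_le_sum fun y _ => ?_
  rw [Fintype.sum_prod_type, Finset.sum_div, ← Finset.sum_add_distrib]
  refine Finset.sum_le_sum fun m _ => ?_
  have hPW : 0 ≤ P x * W x y := mul_nonneg (hP x) ((hW x).1 y)
  have hl := lenc_le hM hK r hr c x m
  have hi0 := ind_nonneg (bad x y (ldec hK pass c m y))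
  have hi1 := ind_le_one (bad x y (ldec hK pass c m y))
  have h1 : lenc r c x m * ind (bad x y (ldec hK pass c m y)) ≤
      (∑ k, r (c (m, k)) x * ind (bad x y (ldec hK pass c m y))) / ((M : ℝ) * K) +
        lenc r c x m * Z := by
    have h2 := mul_le_mul_of_nonneg_right hl hi0
    have h3 : lenc r c x m * Z * ind (bad x y (ldec hK pass c m y)) ≤ lenc r c x m * Z :=
      mul_le_of_le_one_right (mul_nonneg ((hch x).1 m) hZ0) hi1
    rw [← Finset.sum_mul]
    calc _ ≤ _ := h2
      _ = (∑ k, r (c (m, k)) x) * ind (bad x y (ldec hK pass c m y)) / ((M : ℝ) * K) +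
        lenc r c x m * Z * ind (bad x y (ldec hK pass c m y)) := by ring
      _ ≤ _ := by gcongr
  have h4 : ∑ k, r (c (m, k)) x * ind (bad x y (ldec hK pass c m y)) ≤
      ∑ k, (r (c (m, k)) x * ind (¬ pass (c (m, k)) y ∨ bad x y (c (m, k))) +
          ∑ k' ∈ Finset.univ.erase k, r (c (m, k)) x * ind (pass (c (m, k')) y)) := by
    refine Finset.sum_le_sum fun k _ => ?_
    rw [← Finset.mul_sum, ← mul_add]
    exact mul_le_mul_of_nonneg_left (ldec_bad hK pass bad c m k x y) (hr _ _)
  have h5 : (∑ k, r (c (m, k)) x * ind (bad x y (ldec hK pass c m y))) / ((M : ℝ) * K) ≤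
      (∑ k, (r (c (m, k)) x * ind (¬ pass (c (m, k)) y ∨ bad x y (c (m, k))) +
          ∑ k' ∈ Finset.univ.erase k, r (c (m, k)) x * ind (pass (c (m, k')) y))) /
          ((M : ℝ) * K) := by gcongr
  calc _ = P x * W x y * (lenc r c x m * ind (bad x y (ldec hK pass c m y))) := by ring
    _ ≤ P x * W x y * ((∑ k, (r (c (m, k)) x * ind (¬ pass (c (m, k)) y ∨ bad x y (c (m, k))) +
          ∑ k' ∈ Finset.univ.erase k, r (c (m, k)) x * ind (pass (c (m, k')) y))) /
          ((M : ℝ) * K) + lenc r c x m * Z) :=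
        mul_le_mul_of_nonneg_left (h1.trans (by linarith)) hPW
    _ = _ := by rw [mul_add, ← mul_div_assoc, Finset.mul_sum]

lemma exp_err {U X Y : Type*} [Fintype U] [Fintype X] [Fintype Y] {M K : ℕ} (hM : 0 < M)
    (hK : 0 < K) (pU : U → ℝ) (hpU : IsDist pU)
    (P : X → ℝ) (hP : IsDist P) (r : U → X → ℝ)
    (hr : ∀ u x, 0 ≤ r u x) (hr1 : ∀ x, P x ≠ 0 → ∑ u, pU u * r u x = 1)
    (W : X → Y → ℝ) (hW : IsChannel W) (pass : U → Y → Prop)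
    (bad : X → Y → U → Prop) (α β ζ θ T : ℝ)
    (hβ : ∀ y, ∑ u, pU u * ind (pass u y) ≤ β)
    (hα : ∑ u, ∑ x, ∑ y, pU u * r u x * P x * W x y * ind (¬ pass u y ∨ bad x y u) ≤ α)
    (hζ : ∑ u, ∑ x, pU u * r u x * P x * ind (T < r u x) ≤ ζ)
    (hT : 0 ≤ T) (hθ : 0 < θ) (hTθ : T ≤ θ ^ 2 * ((M : ℝ) * K)) :
    ∑ c : Fin M × Fin K → U, (∏ i, pU (c i)) *
      (∑ x, ∑ y, ∑ m, P x * W x y * lenc r c x m * ind (bad x y (ldec hK pass c m y)))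
      ≤ α + ((K : ℝ) - 1) * β + ζ + θ := by
  have hM' : (0:ℝ) < M := by exact_mod_cast hM
  have hK' : (0:ℝ) < K := by exact_mod_cast hK
  have hw : ∀ c : Fin M × Fin K → U, 0 ≤ ∏ i, pU (c i) :=
    fun c => Finset.prod_nonneg fun i _ => hpU.1 _
  have : Nonempty (Fin M × Fin K) := ⟨(⟨0, hM⟩, ⟨0, hK⟩)⟩
  have hcard : ((Fintype.card (Fin M × Fin K) : ℕ) : ℝ) = (M : ℝ) * K := by simp
  have h3 : ∑ c : Fin M × Fin K → U, (∏ i, pU (c i)) *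
      ∑ x, P x * max 0 (1 - (∑ i, r (c i) x) / ((M : ℝ) * K)) ≤ ζ + θ := by
    have e : ∀ c : Fin M × Fin K → U, (∏ i, pU (c i)) *
      ∑ x, P x * max 0 (1 - (∑ i, r (c i) x) / ((M : ℝ) * K)) =
      ∑ x, P x * ((∏ i, pU (c i)) * max 0 (1 - (∑ i, r (c i) x) / ((M : ℝ) * K))) := fun c => by
      rw [Finset.mul_sum]; exact Finset.sum_congr rfl fun x _ => by ring
    simp only [e]
    rw [Finset.sum_comm]
    have hx : ∀ x, ∑ c : Fin M × Fin K → U,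
        P x * ((∏ i, pU (c i)) * max 0 (1 - (∑ i, r (c i) x) / ((M : ℝ) * K))) ≤
        P x * (∑ u, pU u * r u x * ind (T < r u x) + θ) := by
      intro x
      rw [← Finset.mul_sum]
      by_cases hx : P x = 0
      · rw [hx]; simp
      · refine mul_le_mul_of_nonneg_left ?_ (hP.1 x)
        have := cover (I := Fin M × Fin K) pU hpU (fun u => r u x) (fun u => hr u x) (hr1 x hx)
          T θ hT hθ (by rw [hcard]; exact hTθ)
        rw [hcard] at this
        exact this
    calc _ ≤ ∑ x, P x * (∑ u, pU u * r u x * ind (T < r u x) + θ) :=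
          Finset.sum_le_sum fun x _ => hx x
      _ = (∑ u, ∑ x, pU u * r u x * P x * ind (T < r u x)) + θ := by
          simp only [mul_add, Finset.sum_add_distrib]
          rw [← Finset.sum_mul, hP.2, one_mul, Finset.sum_comm (f := fun u x => pU u * r u x * P x * ind (T < r u x))]
          congr 1
          refine Finset.sum_congr rfl fun x _ => ?_
          rw [Finset.mul_sum]
          exact Finset.sum_congr rfl fun u _ => by ring
      _ ≤ _ := by linarith
  have h1 : ∀ i : Fin M × Fin K, ∑ c : Fin M × Fin K → U, (∏ i, pU (c i)) * (∑ x, ∑ y, P x * W x y *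
        (r (c i) x * ind (¬ pass (c i) y ∨ bad x y (c i)) +
          ∑ k' ∈ Finset.univ.erase i.2, r (c i) x * ind (pass (c (i.1, k')) y)))
      ≤ α + ((K : ℝ) - 1) * β := by
    intro i
    have e : ∀ c : Fin M × Fin K → U, (∏ i, pU (c i)) * (∑ x, ∑ y, P x * W x y *
        (r (c i) x * ind (¬ pass (c i) y ∨ bad x y (c i)) +
          ∑ k' ∈ Finset.univ.erase i.2, r (c i) x * ind (pass (c (i.1, k')) y))) =
        ∑ x, ∑ y, P x * W x y *
        ((∏ i, pU (c i)) * (r (c i) x * ind (¬ pass (c i) y ∨ bad x y (c i))) +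
          ∑ k' ∈ Finset.univ.erase i.2, (∏ i, pU (c i)) *
            (r (c i) x * ind (pass (c (i.1, k')) y))) := fun c => by
      rw [Finset.mul_sum]
      refine Finset.sum_congr rfl fun x _ => ?_
      rw [Finset.mul_sum]
      refine Finset.sum_congr rfl fun y _ => ?_
      simp only [← Finset.mul_sum]; ring
    simp only [e]
    rw [Finset.sum_comm]
    have hxy : ∀ x y, ∑ c : Fin M × Fin K → U, P x * W x y *
        ((∏ i, pU (c i)) * (r (c i) x * ind (¬ pass (c i) y ∨ bad x y (c i))) +
          ∑ k' ∈ Finset.univ.erase i.2, (∏ i, pU (c i)) *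
            (r (c i) x * ind (pass (c (i.1, k')) y))) ≤
        (∑ u, pU u * r u x * P x * W x y * ind (¬ pass u y ∨ bad x y u)) +
          P x * W x y * (((K : ℝ) - 1) * β) := by
      intro x y
      rw [← Finset.mul_sum, Finset.sum_add_distrib, mul_add]
      apply add_le_add
      · rw [exp_single pU hpU.2 (fun u => r u x * ind (¬ pass u y ∨ bad x y u)) i, Finset.mul_sum]
        exact le_of_eq (Finset.sum_congr rfl fun u _ => by ring)
      · by_cases hx : P x = 0
        · rw [hx]; simp
        · refine mul_le_mul_of_nonneg_left ?_ (mul_nonneg (hP.1 x) ((hW x).1 y))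
          rw [Finset.sum_comm]
          calc _ ≤ ∑ k' ∈ Finset.univ.erase i.2, β := by
                refine Finset.sum_le_sum fun k' hk' => ?_
                have hne : i ≠ (i.1, k') := fun h => (Finset.mem_erase.1 hk').1
                  (by rw [h])
                rw [exp_pair pU hpU.2 (fun u => r u x) (fun u => ind (pass u y)) i (i.1, k') hne,
                  hr1 x hx, one_mul]
                exact hβ y
            _ = _ := by
                rw [Finset.sum_const, Finset.card_erase_of_mem (Finset.mem_univ _), nsmul_eq_mul]
                simp only [Finset.card_univ, Fintype.card_fin]
                rw [Nat.cast_sub hK]; simp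
    calc _ = ∑ x, ∑ y, ∑ c : Fin M × Fin K → U, P x * W x y *
        ((∏ i, pU (c i)) * (r (c i) x * ind (¬ pass (c i) y ∨ bad x y (c i))) +
          ∑ k' ∈ Finset.univ.erase i.2, (∏ i, pU (c i)) *
            (r (c i) x * ind (pass (c (i.1, k')) y))) :=
          Finset.sum_congr rfl fun x _ => Finset.sum_comm
      _ ≤ ∑ x, ∑ y, ((∑ u, pU u * r u x * P x * W x y * ind (¬ pass u y ∨ bad x y u)) +
          P x * W x y * (((K : ℝ) - 1) * β)) :=
          Finset.sum_le_sum fun x _ => Finset.sum_le_sum fun y _ => hxy x y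
      _ = (∑ u, ∑ x, ∑ y, pU u * r u x * P x * W x y * ind (¬ pass u y ∨ bad x y u)) +
          ((K : ℝ) - 1) * β := by
          simp only [Finset.sum_add_distrib]
          congr 1
          · rw [Finset.sum_comm (s := (Finset.univ : Finset U))]
            exact Finset.sum_congr rfl fun x _ => Finset.sum_comm
          · simp only [← Finset.sum_mul, ← Finset.mul_sum, (hW _).2, mul_one, hP.2, one_mul]
      _ ≤ _ := by linarith
  calc _ ≤ ∑ c : Fin M × Fin K → U, (∏ i, pU (c i)) * ((∑ i : Fin M × Fin K, ∑ x, ∑ y, P x * W x y *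
        (r (c i) x * ind (¬ pass (c i) y ∨ bad x y (c i)) +
          ∑ k' ∈ Finset.univ.erase i.2, r (c i) x * ind (pass (c (i.1, k')) y))) / ((M : ℝ) * K)
      + ∑ x, P x * max 0 (1 - (∑ i, r (c i) x) / ((M : ℝ) * K))) :=
        Finset.sum_le_sum fun c _ => mul_le_mul_of_nonneg_left
          (err_le hM hK P hP.1 r hr W hW pass bad c) (hw c)
    _ = (∑ i : Fin M × Fin K, ∑ c : Fin M × Fin K → U, (∏ i, pU (c i)) * (∑ x, ∑ y, P x * W x y *
        (r (c i) x * ind (¬ pass (c i) y ∨ bad x y (c i)) +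
          ∑ k' ∈ Finset.univ.erase i.2, r (c i) x * ind (pass (c (i.1, k')) y)))) / ((M : ℝ) * K)
       + ∑ c : Fin M × Fin K → U, (∏ i, pU (c i)) *
      ∑ x, P x * max 0 (1 - (∑ i, r (c i) x) / ((M : ℝ) * K)) := by
        simp only [mul_add, Finset.sum_add_distrib (s := (Finset.univ : Finset (Fin M × Fin K → U)))]
        congr 1
        rw [Finset.sum_comm, Finset.sum_div]
        refine Finset.sum_congr rfl fun c _ => ?_
        rw [← mul_div_assoc, Finset.mul_sum]
    _ ≤ (∑ i : Fin M × Fin K, (α + ((K : ℝ) - 1) * β)) / ((M : ℝ) * K) + (ζ + θ) := by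
        gcongr with i _
        exact h1 i
    _ = _ := by
        rw [Finset.sum_const, nsmul_eq_mul, Finset.card_univ, hcard]
        field_simp; ring

lemma oneshot {U X Y ι : Type*} [Fintype U] [Fintype X] [Fintype Y] [Fintype ι] {M K : ℕ}
    (hM : 0 < M) (hK : 0 < K) (pU : U → ℝ) (hpU : IsDist pU)
    (P : X → ℝ) (hP : IsDist P) (r : U → X → ℝ)
    (hr : ∀ u x, 0 ≤ r u x) (hr1 : ∀ x, P x ≠ 0 → ∑ u, pU u * r u x = 1)
    (W : ι → X → Y → ℝ) (hW : ∀ i, IsChannel (W i)) (pass : U → Y → Prop)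
    (bad : X → Y → U → Prop) (α β ζ θ T : ℝ)
    (hβ : ∀ y, ∑ u, pU u * ind (pass u y) ≤ β)
    (hα : ∀ i, ∑ u, ∑ x, ∑ y, pU u * r u x * P x * W i x y * ind (¬ pass u y ∨ bad x y u) ≤ α)
    (hζ : ∑ u, ∑ x, pU u * r u x * P x * ind (T < r u x) ≤ ζ)
    (hT : 0 ≤ T) (hθ : 0 < θ) (hTθ : T ≤ θ ^ 2 * ((M : ℝ) * K)) :
    ∃ enc : X → Fin M → ℝ, IsChannel enc ∧ ∃ dec : Fin M → Y → U, ∀ i,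
      ∑ x, ∑ y, ∑ m, P x * W i x y * enc x m * ind (bad x y (dec m y)) ≤
        Fintype.card ι * (α + ((K : ℝ) - 1) * β + ζ + θ) := by
  set B := α + ((K : ℝ) - 1) * β + ζ + θ with hB
  have hw : ∀ c : Fin M × Fin K → U, 0 ≤ ∏ i, pU (c i) :=
    fun c => Finset.prod_nonneg fun i _ => hpU.1 _
  set err : ι → (Fin M × Fin K → U) → ℝ := fun i c =>
    ∑ x, ∑ y, ∑ m, P x * W i x y * lenc r c x m * ind (bad x y (ldec hK pass c m y)) with herr
  have herr0 : ∀ i c, 0 ≤ err i c := fun i c =>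
    Finset.sum_nonneg fun x _ => Finset.sum_nonneg fun y _ => Finset.sum_nonneg fun m _ =>
      mul_nonneg (mul_nonneg (mul_nonneg (hP.1 x) ((hW i x).1 y)) ((lenc_channel hM r hr c x).1 m))
        (ind_nonneg _)
  have htot : ∑ c : Fin M × Fin K → U, (∏ i, pU (c i)) * ∑ i, err i c ≤ Fintype.card ι * B := by
    simp only [Finset.mul_sum]
    rw [Finset.sum_comm]
    calc _ ≤ ∑ i : ι, B := Finset.sum_le_sum fun i _ =>
          exp_err hM hK pU hpU P hP r hr hr1 (W i) (hW i) pass bad α β ζ θ T hβ (hα i) hζ hT hθ hTθ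
      _ = _ := by simp
  obtain ⟨c, hc⟩ : ∃ c : Fin M × Fin K → U, ∑ i, err i c ≤ Fintype.card ι * B := by
    by_contra hcon
    push Not at hcon
    have h1 := exp_one (I := Fin M × Fin K) pU hpU.2
    obtain ⟨c0, -, hc0⟩ : ∃ c ∈ (Finset.univ : Finset (Fin M × Fin K → U)), 0 < ∏ i, pU (c i) := by
      apply Finset.exists_lt_of_sum_lt
      simp [h1]
    have : ∑ c : Fin M × Fin K → U, (∏ i, pU (c i)) * (Fintype.card ι * B) <
        ∑ c : Fin M × Fin K → U, (∏ i, pU (c i)) * ∑ i, err i c :=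
      Finset.sum_lt_sum (fun c _ => mul_le_mul_of_nonneg_left (hcon c).le (hw c))
        ⟨c0, Finset.mem_univ _, mul_lt_mul_of_pos_left (hcon c0) hc0⟩
    rw [← Finset.sum_mul, h1, one_mul] at this
    linarith
  refine ⟨lenc r c, lenc_channel hM r hr c, ldec hK pass c, fun i => le_trans ?_ hc⟩
  exact Finset.single_le_sum (f := fun i => err i c) (fun i _ => herr0 i c) (Finset.mem_univ i)

lemma chernoff {A : Type*} [Fintype A] (p : A → ℝ) (hp : IsDist p) (g : A → ℝ) (B ε : ℝ)
    (hB : 0 < B) (hε : 0 < ε) (hg : ∀ a, p a ≠ 0 → |g a| ≤ B) (hm : ∑ a, p a * g a ≤ -ε) (n : ℕ)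
    (Q : (Fin n → A) → Prop)
    (hQ : ∀ s : Fin n → A, (∏ t, p (s t)) ≠ 0 → Q s → 0 ≤ ∑ t, g (s t)) :
    ∑ s : Fin n → A, (∏ t, p (s t)) * ind (Q s) ≤ Real.exp (-(n * (ε ^ 2 / (4 * B ^ 2)))) := by
  have hεB : ε ≤ B := by
    have : ∑ a, p a * (-B) ≤ ∑ a, p a * g a := by
      refine Finset.sum_le_sum fun a _ => ?_
      by_cases h : p a = 0
      · simp [h]
      · exact mul_le_mul_of_nonneg_left (abs_le.1 (hg a h)).1 (hp.1 a)
    rw [← Finset.sum_mul, hp.2] at this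
    linarith
  set l := ε / (2 * B ^ 2) with hl
  have hl0 : 0 < l := by positivity
  have hlB : l * B ≤ 1 := by
    have : l * B = ε / (2 * B) := by rw [hl]; field_simp
    rw [this, div_le_one (by positivity)]; linarith
  have h1 : ∑ a, p a * Real.exp (l * g a) ≤ Real.exp (-(ε ^ 2 / (4 * B ^ 2))) := by
    have hpt : ∀ a, p a * Real.exp (l * g a) ≤ p a + l * (p a * g a) + p a * (l * B) ^ 2 := by
      intro a
      by_cases h : p a = 0
      · simp [h]
      · have hga := hg a h
        have habs : |l * g a| ≤ l * B := by
          rw [abs_mul, abs_of_pos hl0]; gcongr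
        have h2 := (abs_le.1 (Real.abs_exp_sub_one_sub_id_le (habs.trans hlB))).2
        have h3 : (l * g a) ^ 2 ≤ (l * B) ^ 2 := sq_le_sq' (abs_le.1 habs).1 (abs_le.1 habs).2
        have h4 : Real.exp (l * g a) ≤ 1 + l * g a + (l * B) ^ 2 := by linarith
        have := mul_le_mul_of_nonneg_left h4 (hp.1 a)
        linarith
    calc _ ≤ ∑ a, (p a + l * (p a * g a) + p a * (l * B) ^ 2) := Finset.sum_le_sum fun a _ => hpt a
      _ = 1 + l * (∑ a, p a * g a) + (l * B) ^ 2 := by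
          rw [Finset.sum_add_distrib, Finset.sum_add_distrib, ← Finset.sum_mul, ← Finset.mul_sum, hp.2]
          ring
      _ ≤ 1 + l * (-ε) + (l * B) ^ 2 := by gcongr
      _ = -(ε ^ 2 / (4 * B ^ 2)) + 1 := by rw [hl]; field_simp; ring
      _ ≤ _ := Real.add_one_le_exp _
  have h0 : 0 ≤ ∑ a, p a * Real.exp (l * g a) :=
    Finset.sum_nonneg fun a _ => mul_nonneg (hp.1 a) (Real.exp_pos _).le
  calc _ ≤ ∑ s : Fin n → A, (∏ t, p (s t)) * ∏ t, Real.exp (l * g (s t)) := by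
        refine Finset.sum_le_sum fun s _ => ?_
        have hs0 : 0 ≤ ∏ t, p (s t) := Finset.prod_nonneg fun t _ => hp.1 _
        by_cases hs : (∏ t, p (s t)) = 0
        · simp [hs]
        · refine mul_le_mul_of_nonneg_left ?_ hs0
          rw [← Real.exp_sum, ← Finset.mul_sum]
          by_cases hq : Q s
          · rw [ind_true hq]
            exact Real.one_le_exp (mul_nonneg hl0.le (hQ s hs hq))
          · rw [ind_false hq]; positivity
    _ = (∑ a, p a * Real.exp (l * g a)) ^ n := by
        rw [exp_prod p (fun _ a => Real.exp (l * g a))]; simp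
    _ ≤ (Real.exp (-(ε ^ 2 / (4 * B ^ 2)))) ^ n := pow_le_pow_left₀ h0 h1 n
    _ = _ := by rw [← Real.exp_nat_mul]; congr 1; ring

lemma sum_seq2 {U X : Type*} [Fintype U] [Fintype X] (n : ℕ) (F : (Fin n → U) → (Fin n → X) → ℝ) :
    ∑ us, ∑ xs, F us xs = ∑ s : Fin n → U × X, F (fun t => (s t).1) (fun t => (s t).2) := by
  rw [← Fintype.sum_prod_type' (f := F)]
  exact (Fintype.sum_equiv (Equiv.arrowProdEquivProdArrow (Fin n) (fun _ => U) (fun _ => X)) _ _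
    (fun s => rfl)).symm

lemma chernoff2 {U X : Type*} [Fintype U] [Fintype X] (p : U → X → ℝ)
    (hp : IsDist (fun a : U × X => p a.1 a.2)) (g : U → X → ℝ) (B ε : ℝ)
    (hB : 0 < B) (hε : 0 < ε) (hg : ∀ u x, p u x ≠ 0 → |g u x| ≤ B)
    (hm : ∑ u, ∑ x, p u x * g u x ≤ -ε) (n : ℕ)
    (Q : (Fin n → U) → (Fin n → X) → Prop)
    (hQ : ∀ us xs, (∀ t, p (us t) (xs t) ≠ 0) → Q us xs → 0 ≤ ∑ t, g (us t) (xs t)) :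
    ∑ us, ∑ xs, (∏ t, p (us t) (xs t)) * ind (Q us xs) ≤
      Real.exp (-(n * (ε ^ 2 / (4 * B ^ 2)))) := by
  rw [sum_seq2]
  refine chernoff (fun a : U × X => p a.1 a.2) hp (fun a => g a.1 a.2) B ε hB hε
    (fun a => hg a.1 a.2) ?_ n (fun s => Q (fun t => (s t).1) (fun t => (s t).2)) ?_
  · rw [Fintype.sum_prod_type]; exact hm
  · intro s hs hq
    exact hQ _ _ (fun t => (Finset.prod_ne_zero_iff.1 hs) t (Finset.mem_univ _)) hq

lemma chernoff3 {U X Y : Type*} [Fintype U] [Fintype X] [Fintype Y] (p : U → X → Y → ℝ)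
    (hp0 : ∀ u x y, 0 ≤ p u x y) (hp1 : ∑ u, ∑ x, ∑ y, p u x y = 1)
    (g : U → X → Y → ℝ) (B ε : ℝ)
    (hB : 0 < B) (hε : 0 < ε) (hg : ∀ u x y, p u x y ≠ 0 → |g u x y| ≤ B)
    (hm : ∑ u, ∑ x, ∑ y, p u x y * g u x y ≤ -ε) (n : ℕ)
    (Q : (Fin n → U) → (Fin n → X) → (Fin n → Y) → Prop)
    (hQ : ∀ us xs ys, (∀ t, p (us t) (xs t) (ys t) ≠ 0) → Q us xs ys →
      0 ≤ ∑ t, g (us t) (xs t) (ys t)) :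
    ∑ us, ∑ xs, ∑ ys, (∏ t, p (us t) (xs t) (ys t)) * ind (Q us xs ys) ≤
      Real.exp (-(n * (ε ^ 2 / (4 * B ^ 2)))) := by
  have e : ∀ us : Fin n → U, ∑ xs : Fin n → X, ∑ ys : Fin n → Y,
      (∏ t, p (us t) (xs t) (ys t)) * ind (Q us xs ys) =
      ∑ s : Fin n → X × Y, (∏ t, p (us t) (s t).1 (s t).2) *
        ind (Q us (fun t => (s t).1) (fun t => (s t).2)) := fun us => sum_seq2 n _
  simp only [e]
  refine chernoff2 (X := X × Y) (fun u a => p u a.1 a.2) ⟨fun a => hp0 _ _ _, ?_⟩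
    (fun u a => g u a.1 a.2) B ε hB hε (fun u a => hg _ _ _) ?_ n
    (fun us s => Q us (fun t => (s t).1) (fun t => (s t).2)) (fun us s hs hq => hQ _ _ _ hs hq)
  · simp only [Fintype.sum_prod_type]; exact hp1
  · simp only [Fintype.sum_prod_type]; exact hm

lemma gibbs {A : Type*} [Fintype A] (p q : A → ℝ) (hp : ∀ a, 0 ≤ p a) (hq : ∀ a, 0 ≤ q a)
    (hpq : ∀ a, p a ≠ 0 → q a ≠ 0) (hs : ∑ a, q a ≤ ∑ a, p a) :
    ∑ a, p a * Real.logb 2 (q a) ≤ ∑ a, p a * Real.logb 2 (p a) := by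
  have h2 : 0 < Real.log 2 := Real.log_pos (by norm_num)
  have key : ∑ a, p a * (Real.log (q a) - Real.log (p a)) ≤ 0 := by
    have : ∀ a, p a * (Real.log (q a) - Real.log (p a)) ≤ q a - p a := by
      intro a
      by_cases h : p a = 0
      · simp [h, hq a]
      · have hpa : 0 < p a := lt_of_le_of_ne (hp a) (Ne.symm h)
        have hqa : 0 < q a := lt_of_le_of_ne (hq a) (Ne.symm (hpq a h))
        rw [← Real.log_div hqa.ne' hpa.ne']
        have := mul_le_mul_of_nonneg_left (Real.log_le_sub_one_of_pos (div_pos hqa hpa)) (hp a)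
        have e : p a * (q a / p a - 1) = q a - p a := by field_simp
        linarith
    calc _ ≤ ∑ a, (q a - p a) := Finset.sum_le_sum fun a _ => this a
      _ ≤ 0 := by rw [Finset.sum_sub_distrib]; linarith
  have e : ∀ f : A → ℝ, ∑ a, p a * Real.logb 2 (f a) = (∑ a, p a * Real.log (f a)) / Real.log 2 := by
    intro f; rw [Finset.sum_div]
    exact Finset.sum_congr rfl fun a _ => by rw [Real.logb, mul_div_assoc]
  rw [e, e]
  simp only [mul_sub, Finset.sum_sub_distrib] at key
  exact div_le_div_of_nonneg_right (by linarith) h2.le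

lemma mutInf_eq {A B : Type*} [Fintype A] [Fintype B] (J : A × B → ℝ) :
    mutInf J = ∑ a, ∑ b, J (a, b) * (Real.logb 2 (J (a, b)) - Real.logb 2 (∑ b', J (a, b')) -
      Real.logb 2 (∑ a', J (a', b))) := by
  simp only [mutInf, ent, mul_sub, Finset.sum_sub_distrib, Finset.sum_mul]
  rw [Fintype.sum_prod_type, Finset.sum_comm (s := (Finset.univ : Finset B))]
  ring

lemma mutInf_nonneg {A B : Type*} [Fintype A] [Fintype B] (J : A × B → ℝ) (hJ : IsDist J) :
    0 ≤ mutInf J := by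
  have h1 := hJ.2
  rw [Fintype.sum_prod_type] at h1
  have hA : ∀ a b, J (a, b) ≠ 0 → ∑ b', J (a, b') ≠ 0 := fun a b h => by
    have := Finset.single_le_sum (f := fun b' => J (a, b')) (fun b' _ => hJ.1 _) (Finset.mem_univ b)
    have h0 := lt_of_le_of_ne (hJ.1 (a, b)) (Ne.symm h)
    linarith
  have hB : ∀ a b, J (a, b) ≠ 0 → ∑ a', J (a', b) ≠ 0 := fun a b h => by
    have := Finset.single_le_sum (f := fun a' => J (a', b)) (fun b' _ => hJ.1 _) (Finset.mem_univ a)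
    have h0 := lt_of_le_of_ne (hJ.1 (a, b)) (Ne.symm h)
    linarith
  have := gibbs J (fun p => (∑ b', J (p.1, b')) * (∑ a', J (a', p.2))) hJ.1
    (fun p => mul_nonneg (Finset.sum_nonneg fun _ _ => hJ.1 _) (Finset.sum_nonneg fun _ _ => hJ.1 _))
    (fun p h => mul_ne_zero (hA _ _ h) (hB _ _ h)) (by
      rw [hJ.2, Fintype.sum_prod_type]
      simp only
      simp only [← Finset.mul_sum, ← Finset.sum_mul]
      rw [h1, Finset.sum_comm, h1]; norm_num)
  rw [mutInf_eq]
  rw [Fintype.sum_prod_type, Fintype.sum_prod_type] at this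
  have e : ∀ a b, J (a, b) * (Real.logb 2 (J (a, b)) - Real.logb 2 (∑ b', J (a, b')) -
      Real.logb 2 (∑ a', J (a', b))) = J (a, b) * Real.logb 2 (J (a, b)) -
      J (a, b) * Real.logb 2 ((∑ b', J (a, b')) * (∑ a', J (a', b))) := fun a b => by
    by_cases h : J (a, b) = 0
    · simp [h]
    · rw [Real.logb_mul (hA a b h) (hB a b h)]; ring
  simp only [e, Finset.sum_sub_distrib]
  simp only at this
  linarith

/-! ### single-letter quantities -/

section single

variable {U X Y : Type*} [Fintype U] [Fintype X] [Fintype Y]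

/-- output law of the test channel. -/
def pU (P : X → ℝ) (V : X → U → ℝ) (u : U) : ℝ := ∑ x, P x * V x u

/-- likelihood ratio. -/
def rr (P : X → ℝ) (V : X → U → ℝ) (u : U) (x : X) : ℝ := V x u / pU P V u

/-- channel mixed with the uniform one. -/
def Wmix (η : ℝ) (W : X → Y → ℝ) (x : X) (y : Y) : ℝ := (1 - η) * W x y + η / Fintype.card Y

/-- channel from `U` to `Y`. -/
def qc (P : X → ℝ) (V : X → U → ℝ) (W : X → Y → ℝ) (u : U) (y : Y) : ℝ :=
  ∑ x, rr P V u x * P x * W x y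

/-- output law. -/
def qm (P : X → ℝ) (W : X → Y → ℝ) (y : Y) : ℝ := ∑ x, P x * W x y

/-- likelihood ratio for the pair `(u,y)`. -/
def rho (P : X → ℝ) (V : X → U → ℝ) (W : X → Y → ℝ) (u : U) (y : Y) : ℝ :=
  qc P V W u y / qm P W y

variable {P : X → ℝ} {V : X → U → ℝ} {W : X → Y → ℝ}


lemma pU_nonneg (hP : IsDist P) (hV : IsChannel V) (u : U) : 0 ≤ pU P V u :=
  Finset.sum_nonneg fun x _ => mul_nonneg (hP.1 x) ((hV x).1 u)

lemma pU_dist (hP : IsDist P) (hV : IsChannel V) : IsDist (pU P V) := by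
  refine ⟨pU_nonneg hP hV, ?_⟩
  unfold pU
  rw [Finset.sum_comm]
  simp only [← Finset.mul_sum, (hV _).2, mul_one, hP.2]

lemma pU_ne (hP : IsDist P) (hV : IsChannel V) {u : U} {x : X} (h : P x * V x u ≠ 0) : pU P V u ≠ 0 := by
  have := Finset.single_le_sum (f := fun x => P x * V x u)
    (fun x _ => mul_nonneg (hP.1 x) ((hV x).1 u)) (Finset.mem_univ x)
  have h0 := lt_of_le_of_ne (mul_nonneg (hP.1 x) ((hV x).1 u)) (Ne.symm h)
  unfold pU
  linarith

lemma rr_nonneg (hP : IsDist P) (hV : IsChannel V) (u : U) (x : X) : 0 ≤ rr P V u x := div_nonneg ((hV x).1 u) (pU_nonneg hP hV u)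

lemma pU_rr (hP : IsDist P) (hV : IsChannel V) (u : U) (x : X) : pU P V u * rr P V u x * P x = P x * V x u := by
  by_cases h : pU P V u = 0
  · have : P x * V x u = 0 := by
      by_contra h'; exact pU_ne hP hV h' h
    rw [h, this]; ring
  · unfold rr; field_simp

lemma rr_sum (hP : IsDist P) (hV : IsChannel V) (x : X) (hx : P x ≠ 0) : ∑ u, pU P V u * rr P V u x = 1 := by
  have : P x * ∑ u, pU P V u * rr P V u x = P x * 1 := by
    rw [Finset.mul_sum, mul_one]
    calc _ = ∑ u, P x * V x u := Finset.sum_congr rfl fun u _ => by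
          rw [← pU_rr hP hV u x]; ring
      _ = P x := by rw [← Finset.mul_sum, (hV x).2, mul_one]
  exact mul_left_cancel₀ hx this

lemma rr_qsum (hP : IsDist P) (hV : IsChannel V) (u : U) (hu : pU P V u ≠ 0) : ∑ x, rr P V u x * P x = 1 := by
  have : pU P V u * ∑ x, rr P V u x * P x = pU P V u * 1 := by
    rw [Finset.mul_sum, mul_one]
    conv_rhs => unfold pU
    refine Finset.sum_congr rfl fun x _ => ?_
    rw [← pU_rr hP hV u x]; ring
  exact mul_left_cancel₀ hu this

lemma pU_qc (hP : IsDist P) (hV : IsChannel V) (W : X → Y → ℝ) (u : U) (y : Y) :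
    pU P V u * qc P V W u y = ∑ x, P x * V x u * W x y := by
  unfold qc
  rw [Finset.mul_sum]
  refine Finset.sum_congr rfl fun x _ => ?_
  rw [← pU_rr hP hV u x]; ring

lemma sum_uy (hP : IsDist P) (hV : IsChannel V) (W : X → Y → ℝ) (y : Y) :
    ∑ u, ∑ x, P x * V x u * W x y = qm P W y := by
  rw [Finset.sum_comm]
  refine Finset.sum_congr rfl fun x _ => ?_
  calc _ = ∑ u, V x u * (P x * W x y) := Finset.sum_congr rfl fun u _ => by ring
    _ = _ := by rw [← Finset.sum_mul, (hV x).2, one_mul]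

lemma rho_sum (hP : IsDist P) (hV : IsChannel V) (W : X → Y → ℝ) (y : Y) (h : qm P W y ≠ 0) :
    ∑ u, pU P V u * rho P V W u y = 1 := by
  unfold rho
  simp only [← mul_div_assoc]
  rw [← Finset.sum_div]
  simp only [pU_qc hP hV, sum_uy hP hV]
  exact div_self h


lemma sum_yx (hP : IsDist P) (hV : IsChannel V) (hW : IsChannel W) (u : U) : ∑ y, ∑ x, P x * V x u * W x y = pU P V u := by
  rw [Finset.sum_comm]
  refine Finset.sum_congr rfl fun x _ => ?_
  rw [← Finset.mul_sum, (hW x).2, mul_one]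

lemma J_dist (hP : IsDist P) (hV : IsChannel V) (hW : IsChannel W) : ∑ u, ∑ x, ∑ y, P x * V x u * W x y = 1 := by
  simp only [← Finset.mul_sum, (hW _).2, mul_one]
  rw [Finset.sum_comm]
  simp only [← Finset.mul_sum, (hV _).2, mul_one, hP.2]

lemma Wmix_bds (hW : IsChannel W) [Nonempty Y] {η : ℝ} (h0 : 0 < η) (h1 : η < 1) (x : X) (y : Y) :
    η / Fintype.card Y ≤ Wmix η W x y ∧ Wmix η W x y ≤ 1 := by
  have hc : (1:ℝ) ≤ Fintype.card Y := by exact_mod_cast Fintype.card_pos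
  have hw0 := (hW x).1 y
  have hw1 : W x y ≤ 1 := by
    rw [← (hW x).2]; exact Finset.single_le_sum (fun y _ => (hW x).1 y) (Finset.mem_univ y)
  unfold Wmix
  constructor
  · have : 0 ≤ (1 - η) * W x y := mul_nonneg (by linarith) hw0
    linarith
  · have : η / Fintype.card Y ≤ η := div_le_self h0.le hc
    nlinarith

lemma Wmix_channel (hW : IsChannel W) [Nonempty Y] {η : ℝ} (h0 : 0 < η) (h1 : η < 1) : IsChannel (Wmix η W) := by
  have hc : (0:ℝ) < Fintype.card Y := by exact_mod_cast Fintype.card_pos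
  intro x
  refine ⟨fun y => le_trans (by positivity) (Wmix_bds hW h0 h1 x y).1, ?_⟩
  unfold Wmix
  rw [Finset.sum_add_distrib, ← Finset.mul_sum, (hW x).2]
  simp only [Finset.sum_const, Finset.card_univ, nsmul_eq_mul]
  field_simp; ring

lemma qm_bds (hP : IsDist P) (hW : IsChannel W) [Nonempty Y] {η : ℝ} (h0 : 0 < η) (h1 : η < 1) (y : Y) :
    η / Fintype.card Y ≤ qm P (Wmix η W) y ∧ qm P (Wmix η W) y ≤ 1 := by
  constructor
  · calc _ = ∑ x, P x * (η / Fintype.card Y) := by rw [← Finset.sum_mul, hP.2, one_mul]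
      _ ≤ _ := Finset.sum_le_sum fun x _ =>
        mul_le_mul_of_nonneg_left (Wmix_bds hW h0 h1 x y).1 (hP.1 x)
  · calc _ ≤ ∑ x, P x * 1 := Finset.sum_le_sum fun x _ =>
        mul_le_mul_of_nonneg_left (Wmix_bds hW h0 h1 x y).2 (hP.1 x)
      _ = 1 := by rw [← Finset.sum_mul, hP.2, one_mul]

lemma qc_bds (hP : IsDist P) (hV : IsChannel V) (hW : IsChannel W) [Nonempty Y] {η : ℝ} (h0 : 0 < η) (h1 : η < 1) (u : U) (hu : pU P V u ≠ 0) (y : Y) :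
    η / Fintype.card Y ≤ qc P V (Wmix η W) u y ∧ qc P V (Wmix η W) u y ≤ 1 := by
  have hn : ∀ x, 0 ≤ rr P V u x * P x := fun x => mul_nonneg (rr_nonneg hP hV u x) (hP.1 x)
  constructor
  · calc _ = ∑ x, rr P V u x * P x * (η / Fintype.card Y) := by
          rw [← Finset.sum_mul, rr_qsum hP hV u hu, one_mul]
      _ ≤ _ := Finset.sum_le_sum fun x _ =>
        mul_le_mul_of_nonneg_left (Wmix_bds hW h0 h1 x y).1 (hn x)
  · calc _ ≤ ∑ x, rr P V u x * P x * 1 := Finset.sum_le_sum fun x _ =>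
        mul_le_mul_of_nonneg_left (Wmix_bds hW h0 h1 x y).2 (hn x)
      _ = 1 := by rw [← Finset.sum_mul, rr_qsum hP hV u hu, one_mul]

lemma rho_bds (hP : IsDist P) (hV : IsChannel V) (hW : IsChannel W) [Nonempty Y] {η : ℝ} (h0 : 0 < η) (h1 : η < 1) (u : U) (hu : pU P V u ≠ 0) (y : Y) :
    0 < rho P V (Wmix η W) u y ∧
    |Real.logb 2 (rho P V (Wmix η W) u y)| ≤ Real.logb 2 (Fintype.card Y / η) := by
  have hc : (0:ℝ) < Fintype.card Y := by exact_mod_cast Fintype.card_pos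
  have a := qc_bds hP hV hW h0 h1 u hu y
  have b := qm_bds hP hW h0 h1 y
  set m := η / Fintype.card Y with hm
  have hm0 : 0 < m := by positivity
  have ha : 0 < qc P V (Wmix η W) u y := hm0.trans_le a.1
  have hb : 0 < qm P (Wmix η W) y := hm0.trans_le b.1
  refine ⟨div_pos ha hb, ?_⟩
  have e : Real.logb 2 (Fintype.card Y / η) = - Real.logb 2 m := by
    rw [hm, ← Real.logb_inv, inv_div]
  have l1 := Real.logb_le_logb_of_le (b := 2) (by norm_num) hm0 a.1
  have l2 := Real.logb_le_logb_of_le (b := 2) (by norm_num) hm0 b.1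
  have l3 := Real.logb_nonpos (b := 2) (by norm_num) ha.le a.2
  have l4 := Real.logb_nonpos (b := 2) (by norm_num) hb.le b.2
  unfold rho
  rw [Real.logb_div ha.ne' hb.ne', e, abs_le]
  constructor <;> linarith

/-- `I(U;Y)` is attained up to `log (1-η)` by the mixed metric. -/
lemma mean_rho (hP : IsDist P) (hV : IsChannel V) (hW : IsChannel W) [Nonempty Y] {η : ℝ} (h0 : 0 < η) (h1 : η < 1) :
    mutInf (fun p : U × Y => ∑ x, P x * V x p.1 * W x p.2) + Real.logb 2 (1 - η) ≤
      ∑ u, ∑ x, ∑ y, P x * V x u * W x y * Real.logb 2 (rho P V (Wmix η W) u y) := by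
  have hc : (0:ℝ) < Fintype.card Y := by exact_mod_cast Fintype.card_pos
  have hJ0 : ∀ u y, 0 ≤ ∑ x, P x * V x u * W x y := fun u y =>
    Finset.sum_nonneg fun x _ => mul_nonneg (mul_nonneg (hP.1 x) ((hV x).1 u)) ((hW x).1 y)
  have hJ1 : ∑ u, ∑ y, ∑ x, P x * V x u * W x y = 1 := by
    simp only [sum_yx hP hV hW, (pU_dist hP hV).2]
  have hqm0 : ∀ y, 0 ≤ qm P W y := fun y =>
    Finset.sum_nonneg fun x _ => mul_nonneg (hP.1 x) ((hW x).1 y)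
  have hqm' : ∀ y, 0 < qm P (Wmix η W) y := fun y =>
    lt_of_lt_of_le (by positivity) (qm_bds hP hW h0 h1 y).1
  have hqs : ∀ W' : X → Y → ℝ, IsChannel W' → ∑ y, qm P W' y = 1 := fun W' hW' => by
    unfold qm; rw [Finset.sum_comm]
    simp only [← Finset.mul_sum, (hW' _).2, mul_one, hP.2]
  rw [mutInf_eq]
  simp only [sum_uy hP hV, sum_yx hP hV hW]
  have hgib := gibbs (qm P W) (qm P (Wmix η W)) hqm0 (fun y => (hqm' y).le) (fun y _ => (hqm' y).ne')
    (by rw [hqs _ hW, hqs _ (Wmix_channel hW h0 h1)])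
  have e2 : ∀ f : Y → ℝ, ∑ y, qm P W y * f y = ∑ u, ∑ y, (∑ x, P x * V x u * W x y) * f y := by
    intro f
    rw [Finset.sum_comm]
    refine Finset.sum_congr rfl fun y _ => ?_
    rw [← Finset.sum_mul, sum_uy hP hV]
  rw [e2, e2] at hgib
  have e3 : ∑ u, ∑ x, ∑ y, P x * V x u * W x y * Real.logb 2 (rho P V (Wmix η W) u y) =
      ∑ u, ∑ y, (∑ x, P x * V x u * W x y) * Real.logb 2 (rho P V (Wmix η W) u y) := by
    refine Finset.sum_congr rfl fun u _ => ?_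
    rw [Finset.sum_comm]
    simp only [Finset.sum_mul]
  have e4 : Real.logb 2 (1 - η) = ∑ u, ∑ y, (∑ x, P x * V x u * W x y) * Real.logb 2 (1 - η) := by
    simp only [← Finset.sum_mul]; rw [hJ1, one_mul]
  have hpt : ∀ u y, (∑ x, P x * V x u * W x y) * (Real.logb 2 (∑ x, P x * V x u * W x y) -
      Real.logb 2 (pU P V u) - Real.logb 2 (qm P W y)) +
      (∑ x, P x * V x u * W x y) * Real.logb 2 (1 - η) ≤
      (∑ x, P x * V x u * W x y) * Real.logb 2 (rho P V (Wmix η W) u y) -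
      (∑ x, P x * V x u * W x y) * Real.logb 2 (qm P W y) +
      (∑ x, P x * V x u * W x y) * Real.logb 2 (qm P (Wmix η W) y) := by
    intro u y
    set J := ∑ x, P x * V x u * W x y with hJ
    by_cases hz : J = 0
    · simp [hz]
    · have hJpos : 0 < J := lt_of_le_of_ne (hJ0 u y) (Ne.symm hz)
      have hu : pU P V u ≠ 0 := by
        intro h
        apply hz
        rw [hJ, ← pU_qc hP hV, h, zero_mul]
      have hu' : 0 < pU P V u := lt_of_le_of_ne (pU_nonneg hP hV u) (Ne.symm hu)
      have hqc := qc_bds hP hV hW h0 h1 u hu y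
      have hqc0 : 0 < qc P V (Wmix η W) u y := lt_of_lt_of_le (by positivity) hqc.1
      have hge : (1 - η) * J / pU P V u ≤ qc P V (Wmix η W) u y := by
        rw [div_le_iff₀ hu', mul_comm (qc _ _ _ _ _), pU_qc hP hV, hJ, Finset.mul_sum]
        refine Finset.sum_le_sum fun x _ => ?_
        have h5 : 0 ≤ P x * V x u * (η / Fintype.card Y) :=
          mul_nonneg (mul_nonneg (hP.1 x) ((hV x).1 u)) (by positivity)
        unfold Wmix
        nlinarith
      have h1η : 0 < 1 - η := by linarith
      have l := Real.logb_le_logb_of_le (b := 2) (by norm_num) (by positivity) hge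
      rw [Real.logb_div (by positivity) hu, Real.logb_mul h1η.ne' hz] at l
      unfold rho
      rw [Real.logb_div hqc0.ne' (hqm' y).ne']
      have := mul_le_mul_of_nonneg_left l hJpos.le
      nlinarith
  have hsum := Finset.sum_le_sum fun u (_ : u ∈ Finset.univ) =>
    Finset.sum_le_sum fun y (_ : y ∈ Finset.univ) => hpt u y
  simp only [Finset.sum_add_distrib, Finset.sum_sub_distrib] at hsum
  rw [← e4] at hsum
  rw [e3]
  linarith

/-- `I(U;X)` as a mean. -/
lemma mean_rr (hP : IsDist P) (hV : IsChannel V) : ∑ u, ∑ x, P x * V x u * Real.logb 2 (rr P V u x) =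
    mutInf (fun p : U × X => P p.2 * V p.2 p.1) := by
  rw [mutInf_eq]
  refine Finset.sum_congr rfl fun u _ => Finset.sum_congr rfl fun x _ => ?_
  by_cases h : P x * V x u = 0
  · simp [h]
  · have hu := pU_ne hP hV h
    have hp := left_ne_zero_of_mul h
    have hv := right_ne_zero_of_mul h
    have e : ∑ u', P x * V x u' = P x := by rw [← Finset.mul_sum, (hV x).2, mul_one]
    simp only [e]
    change _ = P x * V x u * (Real.logb 2 (P x * V x u) - Real.logb 2 (pU P V u) - _)
    unfold rr
    rw [Real.logb_div hv hu, Real.logb_mul hp hv]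
    ring

lemma phi_nonneg_aux (hP : IsDist P) (hV : IsChannel V) (hW : IsChannel W) : 0 ≤ mutInf (fun p : U × X => P p.2 * V p.2 p.1) -
    mutInf (fun p : U × Y => ∑ x, P x * V x p.1 * W x p.2) := by
  have hJ0 : ∀ u y, 0 ≤ ∑ x, P x * V x u * W x y := fun u y =>
    Finset.sum_nonneg fun x _ => mul_nonneg (mul_nonneg (hP.1 x) ((hV x).1 u)) ((hW x).1 y)
  have hqm0 : ∀ y, 0 ≤ qm P W y := fun y =>
    Finset.sum_nonneg fun x _ => mul_nonneg (hP.1 x) ((hW x).1 y)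
  have h3 : ∀ u x y, 0 ≤ P x * V x u * W x y := fun u x y =>
    mul_nonneg (mul_nonneg (hP.1 x) ((hV x).1 u)) ((hW x).1 y)
  have hJne : ∀ u x y, P x * V x u * W x y ≠ 0 → ∑ x, P x * V x u * W x y ≠ 0 := fun u x y h => by
    have := Finset.single_le_sum (f := fun x => P x * V x u * W x y)
      (fun x _ => h3 u x y) (Finset.mem_univ x)
    have h0 := lt_of_le_of_ne (h3 u x y) (Ne.symm h)
    linarith
  have hqne : ∀ u x y, P x * V x u * W x y ≠ 0 → qm P W y ≠ 0 := fun u x y h => by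
    have hPW : P x * W x y ≠ 0 := by
      intro h'; apply h
      calc P x * V x u * W x y = (P x * W x y) * V x u := by ring
        _ = 0 := by rw [h']; ring
    have := Finset.single_le_sum (f := fun x => P x * W x y)
      (fun x _ => mul_nonneg (hP.1 x) ((hW x).1 y)) (Finset.mem_univ x)
    have h0 := lt_of_le_of_ne (mul_nonneg (hP.1 x) ((hW x).1 y)) (Ne.symm hPW)
    unfold qm
    linarith
  have hqs : ∑ y, qm P W y = 1 := by
    unfold qm; rw [Finset.sum_comm]
    simp only [← Finset.mul_sum, (hW _).2, mul_one, hP.2]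
  have hg := gibbs (fun a : U × X × Y => P a.2.1 * V a.2.1 a.1 * W a.2.1 a.2.2)
    (fun a : U × X × Y => (∑ x, P x * V x a.1 * W x a.2.2) * (P a.2.1 * W a.2.1 a.2.2) /
      qm P W a.2.2) (fun a => h3 _ _ _)
    (fun a => div_nonneg (mul_nonneg (hJ0 _ _) (mul_nonneg (hP.1 _) ((hW _).1 _))) (hqm0 _))
    (fun a h => div_ne_zero (mul_ne_zero (hJne _ _ _ h) (by
      intro h'; apply h
      calc _ = (P a.2.1 * W a.2.1 a.2.2) * V a.2.1 a.1 := by ring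
        _ = 0 := by rw [h']; ring)) (hqne _ _ _ h))
    (by
      simp only [Fintype.sum_prod_type]
      rw [J_dist hP hV hW]
      have e : ∀ u, ∑ x, ∑ y, (∑ x, P x * V x u * W x y) * (P x * W x y) / qm P W y =
          ∑ y, (∑ x, P x * V x u * W x y) * qm P W y / qm P W y := fun u => by
        rw [Finset.sum_comm]
        refine Finset.sum_congr rfl fun y _ => ?_
        rw [← Finset.sum_div, ← Finset.mul_sum]
        rfl
      simp only [e]
      rw [Finset.sum_comm, ← hqs]
      refine Finset.sum_le_sum fun y _ => ?_
      rw [← Finset.sum_div, ← Finset.sum_mul, sum_uy hP hV]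
      by_cases h : qm P W y = 0
      · simp [h]
      · rw [mul_div_assoc, div_self h, mul_one])
  simp only [Fintype.sum_prod_type] at hg
  rw [← mean_rr hP hV, mutInf_eq]
  simp only [sum_uy hP hV, sum_yx hP hV hW]
  have e1 : ∑ u, ∑ x, P x * V x u * Real.logb 2 (rr P V u x) =
      ∑ u, ∑ x, ∑ y, P x * V x u * W x y * Real.logb 2 (rr P V u x) := by
    refine Finset.sum_congr rfl fun u _ => Finset.sum_congr rfl fun x _ => ?_
    rw [← Finset.sum_mul, ← Finset.mul_sum, (hW x).2, mul_one]
  have e2 : ∑ u, ∑ y, (∑ x, P x * V x u * W x y) * (Real.logb 2 (∑ x, P x * V x u * W x y) -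
      Real.logb 2 (pU P V u) - Real.logb 2 (qm P W y)) =
      ∑ u, ∑ x, ∑ y, P x * V x u * W x y * (Real.logb 2 (∑ x, P x * V x u * W x y) -
      Real.logb 2 (pU P V u) - Real.logb 2 (qm P W y)) := by
    refine Finset.sum_congr rfl fun u _ => ?_
    rw [Finset.sum_comm]
    simp only [Finset.sum_mul]
  rw [e1, e2]
  refine le_trans (sub_nonneg.2 hg) (le_of_eq ?_)
  simp only [← Finset.sum_sub_distrib]
  refine Finset.sum_congr rfl fun u _ => Finset.sum_congr rfl fun x _ =>
    Finset.sum_congr rfl fun y _ => ?_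
  by_cases h : P x * V x u * W x y = 0
  · simp [h]
  · have hw := right_ne_zero_of_mul h
    have hpv := left_ne_zero_of_mul h
    have hp := left_ne_zero_of_mul hpv
    have hv := right_ne_zero_of_mul hpv
    unfold rr
    rw [Real.logb_div hv (pU_ne hP hV hpv), Real.logb_div (mul_ne_zero (hJne _ _ _ h)
      (mul_ne_zero hp hw)) (hqne _ _ _ h), Real.logb_mul (hJne _ _ _ h) (mul_ne_zero hp hw),
      Real.logb_mul hp hw, Real.logb_mul hpv hw, Real.logb_mul hp hv]
    ring

end single

/-! ### sequence level -/

lemma iid_dist {A : Type*} [Fintype A] {P : A → ℝ} (hP : IsDist P) (n : ℕ) : IsDist (iid P n) := by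
  refine ⟨fun s => Finset.prod_nonneg fun t _ => hP.1 _, ?_⟩
  exact exp_one (I := Fin n) P hP.2

lemma memoryless_channel {A B : Type*} [Fintype A] [Fintype B] {W : A → B → ℝ} (hW : IsChannel W)
    (n : ℕ) : IsChannel (memoryless W n) := by
  intro xs
  refine ⟨fun s => Finset.prod_nonneg fun t _ => (hW _).1 _, ?_⟩
  unfold memoryless
  have := Finset.prod_univ_sum (fun _ : Fin n => (Finset.univ : Finset B)) (fun t b => W (xs t) b)
  rw [Fintype.piFinset_univ] at this
  rw [← this]
  simp [(hW _).2]

lemma rpow_two_logb_prod {n : ℕ} (f : Fin n → ℝ) (hf : ∀ t, 0 < f t) :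
    Real.logb 2 (∏ t, f t) = ∑ t, Real.logb 2 (f t) :=
  Real.logb_prod _ _ fun t _ => (hf t).ne'

lemma zeta_bound {U X : Type*} [Fintype U] [Fintype X] {P : X → ℝ} {V : X → U → ℝ} (hP : IsDist P)
    (hV : IsChannel V) (ε : ℝ) (hε : 0 < ε) : ∃ B > (0:ℝ), ∀ n : ℕ,
    ∑ us : Fin n → U, ∑ xs : Fin n → X, iid (pU P V) n us * (∏ t, rr P V (us t) (xs t)) * iid P n xs *
      ind ((2:ℝ) ^ ((n : ℝ) * (mutInf (fun p : U × X => P p.2 * V p.2 p.1) + ε)) <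
        ∏ t, rr P V (us t) (xs t)) ≤ Real.exp (-(n * (ε ^ 2 / (4 * B ^ 2)))) := by
  set I := mutInf (fun p : U × X => P p.2 * V p.2 p.1) with hI
  set g : U → X → ℝ := fun u x => Real.logb 2 (rr P V u x) - (I + ε) with hg
  refine ⟨∑ u, ∑ x, |g u x| + 1, ?_, fun n => ?_⟩
  · have : 0 ≤ ∑ u, ∑ x, |g u x| :=
      Finset.sum_nonneg fun u _ => Finset.sum_nonneg fun x _ => abs_nonneg _
    linarith
  have hsum1 : ∑ u, ∑ x, P x * V x u = 1 := (pU_dist hP hV).2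
  have hch := chernoff2 (fun u x => P x * V x u)
    ⟨fun a => mul_nonneg (hP.1 _) ((hV _).1 _), by rw [Fintype.sum_prod_type]; exact hsum1⟩
    g (∑ u, ∑ x, |g u x| + 1) ε (by
      have : 0 ≤ ∑ u, ∑ x, |g u x| :=
        Finset.sum_nonneg fun u _ => Finset.sum_nonneg fun x _ => abs_nonneg _
      linarith) hε (fun u x _ => by
      have h1 := Finset.single_le_sum (f := fun x => |g u x|) (fun x _ => abs_nonneg _)
        (Finset.mem_univ x)
      have h2 := Finset.single_le_sum (f := fun u => ∑ x, |g u x|)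
        (fun u _ => Finset.sum_nonneg fun x _ => abs_nonneg _) (Finset.mem_univ u)
      linarith) (by
      simp only [hg, mul_sub, Finset.sum_sub_distrib]
      rw [mean_rr hP hV]
      simp only [← Finset.sum_mul]
      rw [hsum1]; linarith) n
    (fun us xs => (2:ℝ) ^ ((n : ℝ) * (I + ε)) < ∏ t, rr P V (us t) (xs t))
    (fun us xs hne hq => by
      have hpos : ∀ t, 0 < rr P V (us t) (xs t) := fun t => by
        refine lt_of_le_of_ne (rr_nonneg hP hV _ _) (Ne.symm ?_)
        exact div_ne_zero (right_ne_zero_of_mul (hne t)) (pU_ne hP hV (hne t))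
      have := Real.logb_le_logb_of_le (b := 2) (by norm_num) (by positivity) hq.le
      rw [Real.logb_rpow (by norm_num) (by norm_num), rpow_two_logb_prod _ hpos] at this
      simp only [hg, Finset.sum_sub_distrib]
      simp only [Finset.sum_const, Finset.card_univ, Fintype.card_fin, nsmul_eq_mul]
      linarith)
  refine le_trans (le_of_eq ?_) hch
  refine Finset.sum_congr rfl fun us _ => Finset.sum_congr rfl fun xs _ => ?_
  congr 1
  unfold iid
  rw [← Finset.prod_mul_distrib, ← Finset.prod_mul_distrib]
  exact Finset.prod_congr rfl fun t _ => pU_rr hP hV _ _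

lemma dist_bound {X Y Xh : Type*} [Fintype X] [Fintype Y] [Fintype Xh] [DecidableEq Y]
    {P : X → ℝ} (hP : IsDist P) (d : X → Xh → ℝ) (D δ : ℝ) (hδ : 0 < δ)
    {V : X → (Y → Xh) → ℝ} (hV : IsChannel V) : ∃ B > (0:ℝ), ∀ n : ℕ, 1 ≤ n →
    ∀ W : X → Y → ℝ, IsChannel W → dVW P d V W ≤ D →
    ∑ us : Fin n → (Y → Xh), ∑ xs : Fin n → X, ∑ ys : Fin n → Y,
      (∏ t, P (xs t) * V (xs t) (us t) * W (xs t) (ys t)) *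
      ind (D + δ < dseq d n xs (fun t => us t (ys t))) ≤
        Real.exp (-(n * (δ ^ 2 / (4 * B ^ 2)))) := by
  have hs : 0 ≤ ∑ x, ∑ z, |d x z| :=
      Finset.sum_nonneg fun u _ => Finset.sum_nonneg fun x _ => abs_nonneg _
  refine ⟨∑ x, ∑ z, |d x z| + |D + δ| + 1, by positivity, fun n hn W hW hd => ?_⟩
  have hn' : (0:ℝ) < n := by exact_mod_cast hn
  refine chernoff3 (fun u x y => P x * V x u * W x y)
    (fun u x y => mul_nonneg (mul_nonneg (hP.1 x) ((hV x).1 u)) ((hW x).1 y))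
    (J_dist hP hV hW) (fun u x y => d x (u y) - (D + δ)) _ δ (by positivity) hδ
    (fun u x y _ => ?_) ?_ n _ ?_
  · have h1 := Finset.single_le_sum (f := fun z => |d x z|) (fun x _ => abs_nonneg _)
        (Finset.mem_univ (u y))
    have h2 := Finset.single_le_sum (f := fun u => ∑ x, |d u x|)
        (fun u _ => Finset.sum_nonneg fun x _ => abs_nonneg _) (Finset.mem_univ x)
    have := abs_sub (d x (u y)) (D + δ)
    linarith
  · simp only [mul_sub, Finset.sum_sub_distrib]
    unfold dVW at hd
    simp only [← Finset.sum_mul]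
    rw [J_dist hP hV hW]
    linarith
  · intro us xs ys _ hq
    unfold dseq at hq
    rw [lt_div_iff₀ hn'] at hq
    simp only [Finset.sum_sub_distrib]
    simp only [Finset.sum_const, Finset.card_univ, Fintype.card_fin, nsmul_eq_mul]
    linarith

lemma miss_bound {U X Y : Type*} [Fintype X] [Fintype Y] [Fintype U] [Nonempty Y]
    {P : X → ℝ} (hP : IsDist P) {V : X → U → ℝ} (hV : IsChannel V) (η ε γ : ℝ) (h0 : 0 < η)
    (h1 : η < 1) (hε : 0 < ε) :
    ∃ B > (0:ℝ), ∀ n : ℕ, ∀ W : X → Y → ℝ, IsChannel W →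
    γ + ε ≤ mutInf (fun p : U × Y => ∑ x, P x * V x p.1 * W x p.2) + Real.logb 2 (1 - η) →
    ∑ us : Fin n → U, ∑ xs : Fin n → X, ∑ ys : Fin n → Y,
      (∏ t, P (xs t) * V (xs t) (us t) * W (xs t) (ys t)) *
      ind (¬ ((2:ℝ) ^ ((n:ℝ) * γ) < ∏ t, rho P V (Wmix η W) (us t) (ys t))) ≤
        Real.exp (-(n * (ε ^ 2 / (4 * B ^ 2)))) := by
  refine ⟨|γ| + |Real.logb 2 (Fintype.card Y / η)| + 1, by positivity, fun n W hW hd => ?_⟩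
  have hne : ∀ u x y, P x * V x u * W x y ≠ 0 → pU P V u ≠ 0 := fun u x y h =>
    pU_ne hP hV (left_ne_zero_of_mul h)
  refine chernoff3 (fun u x y => P x * V x u * W x y)
    (fun u x y => mul_nonneg (mul_nonneg (hP.1 x) ((hV x).1 u)) ((hW x).1 y))
    (J_dist hP hV hW) (fun u x y => γ - Real.logb 2 (rho P V (Wmix η W) u y)) _ ε (by positivity) hε
    (fun u x y h => ?_) ?_ n _ ?_
  · have h1 := (rho_bds hP hV hW h0 h1 u (hne u x y h) y).2
    have := abs_sub γ (Real.logb 2 (rho P V (Wmix η W) u y))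
    linarith [le_abs_self (Real.logb 2 (Fintype.card Y / η))]
  · simp only [mul_sub, Finset.sum_sub_distrib]
    simp only [← Finset.sum_mul]
    rw [J_dist hP hV hW]
    have := mean_rho hP hV hW h0 h1
    linarith
  · intro us xs ys hz hq
    have hpos : ∀ t, 0 < rho P V (Wmix η W) (us t) (ys t) := fun t =>
      (rho_bds hP hV hW h0 h1 _ (hne _ _ _ (hz t)) _).1
    have := Real.logb_le_logb_of_le (b := 2) (by norm_num)
      (Finset.prod_pos fun t _ => hpos t) (not_lt.1 hq)
    rw [Real.logb_rpow (by norm_num) (by norm_num), rpow_two_logb_prod _ hpos] at this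
    simp only [Finset.sum_sub_distrib]
    simp only [Finset.sum_const, Finset.card_univ, Fintype.card_fin, nsmul_eq_mul]
    linarith

lemma false_bound {U X Y ι : Type*} [Fintype X] [Fintype Y] [Fintype U] [Fintype ι]
    {P : X → ℝ} (hP : IsDist P) {V : X → U → ℝ} (hV : IsChannel V) (W : ι → X → Y → ℝ)
    (hW : ∀ i u y, 0 ≤ rho P V (W i) u y) (hq : ∀ i y, qm P (W i) y ≠ 0) (γ : ℝ) (n : ℕ)
    (ys : Fin n → Y) :
    ∑ us : Fin n → U, iid (pU P V) n us *
      ind (∃ i, (2:ℝ) ^ ((n:ℝ) * γ) < ∏ t, rho P V (W i) (us t) (ys t)) ≤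
      Fintype.card ι * (2:ℝ) ^ (-((n:ℝ) * γ)) := by
  have hp : (0:ℝ) < (2:ℝ) ^ ((n:ℝ) * γ) := by positivity
  calc _ ≤ ∑ us : Fin n → U, iid (pU P V) n us *
      ∑ i, (∏ t, rho P V (W i) (us t) (ys t)) * (2:ℝ) ^ (-((n:ℝ) * γ)) := by
        refine Finset.sum_le_sum fun us _ => mul_le_mul_of_nonneg_left ?_
          ((iid_dist (pU_dist hP hV) n).1 us)
        have hnn : ∀ i ∈ (Finset.univ : Finset ι),
            0 ≤ (∏ t, rho P V (W i) (us t) (ys t)) * (2:ℝ) ^ (-((n:ℝ) * γ)) := fun i _ =>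
          mul_nonneg (Finset.prod_nonneg fun t _ => hW _ _ _) (by positivity)
        by_cases h : ∃ i, (2:ℝ) ^ ((n:ℝ) * γ) < ∏ t, rho P V (W i) (us t) (ys t)
        · rw [ind_true h]
          obtain ⟨i, hi⟩ := h
          refine le_trans ?_ (Finset.single_le_sum hnn (Finset.mem_univ i))
          rw [Real.rpow_neg (by norm_num), ← div_eq_mul_inv, one_le_div hp]
          exact hi.le
        · rw [ind_false h]; exact Finset.sum_nonneg hnn
    _ = ∑ i : ι, (2:ℝ) ^ (-((n:ℝ) * γ)) := by
        simp only [Finset.mul_sum]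
        rw [Finset.sum_comm]
        refine Finset.sum_congr rfl fun i _ => ?_
        simp only [← mul_assoc]
        rw [← Finset.sum_mul]
        have := exp_prod (I := Fin n) (pU P V) (fun t u => rho P V (W i) u (ys t))
        unfold iid
        rw [this]
        simp [rho_sum hP hV (W i) _ (hq i _)]
    _ = _ := by simp

/-! ### the code at a fixed blocklength -/

lemma rho_nonneg {U X Y : Type*} [Fintype U] [Fintype X] [Fintype Y] {P : X → ℝ} {V : X → U → ℝ}
    {W : X → Y → ℝ} (hP : IsDist P) (hV : IsChannel V) (hW : IsChannel W) (u : U) (y : Y) :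
    0 ≤ rho P V W u y :=
  div_nonneg (Finset.sum_nonneg fun x _ => mul_nonneg (mul_nonneg (rr_nonneg hP hV u x) (hP.1 x))
    ((hW x).1 y)) (Finset.sum_nonneg fun x _ => mul_nonneg (hP.1 x) ((hW x).1 y))

lemma code_n {X Y Xh : Type*} [Fintype X] [Fintype Y] [Fintype Xh] [DecidableEq Y]
    [Nonempty Y] {P : X → ℝ} (hP : IsDist P) (e : X → Y → ℝ)
    (d : X → Xh → ℝ) (D E : ℝ) {V : X → (Y → Xh) → ℝ} (hV : IsChannel V)
    (hVd : ∀ W ∈ W1 P e E, dVW P d V W ≤ D) (δ φm ε η γ I : ℝ)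
    (hI : I = mutInf (fun p : (Y → Xh) × X => P p.2 * V p.2 p.1))
    (hγ : γ = I - φm - 2 * ε)
    (h0 : 0 < η) (h1 : η < 1) (hη : Real.logb 2 (1 - η) = -ε)
    (hφ : ∀ W ∈ W1 P e E, phi P V W ≤ φm) (n : ℕ) (hn : 1 ≤ n) (e1 e2 e3 : ℝ)
    (he1 : 0 ≤ e1) (he2 : 0 ≤ e2) (he3 : 0 ≤ e3)
    (hz : ∑ us : Fin n → (Y → Xh), ∑ xs : Fin n → X,
      iid (pU P V) n us * (∏ t, rr P V (us t) (xs t)) * iid P n xs *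
      ind ((2:ℝ) ^ ((n : ℝ) * (I + ε)) < ∏ t, rr P V (us t) (xs t)) ≤ e1)
    (hd : ∀ W : X → Y → ℝ, IsChannel W → dVW P d V W ≤ D →
      ∑ us : Fin n → (Y → Xh), ∑ xs : Fin n → X, ∑ ys : Fin n → Y,
      (∏ t, P (xs t) * V (xs t) (us t) * W (xs t) (ys t)) *
      ind (D + δ < dseq d n xs (fun t => us t (ys t))) ≤ e2)
    (hm : ∀ W : X → Y → ℝ, IsChannel W →
      γ + ε ≤ mutInf (fun p : (Y → Xh) × Y => ∑ x, P x * V x p.1 * W x p.2) + Real.logb 2 (1 - η) →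
      ∑ us : Fin n → (Y → Xh), ∑ xs : Fin n → X, ∑ ys : Fin n → Y,
      (∏ t, P (xs t) * V (xs t) (us t) * W (xs t) (ys t)) *
      ind (¬ ((2:ℝ) ^ ((n:ℝ) * γ) < ∏ t, rho P V (Wmix η W) (us t) (ys t))) ≤ e3) :
    ∃ C : Code X Y Xh n, (C.M : ℝ) ≤ (2:ℝ) ^ ((n:ℝ) * (φm + 6 * ε)) + 1 ∧
      ∀ W ∈ W1 P e E, isCondType n W →
        C.excessProb P d (memoryless W n) (D + δ) ≤
          ((n:ℝ) + 1) ^ (Fintype.card X * Fintype.card Y) *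
            (e3 + e2 + ((n:ℝ) + 1) ^ (Fintype.card X * Fintype.card Y) * (2:ℝ) ^ (-((n:ℝ) * ε)) +
              e1 + (2:ℝ) ^ (-((n:ℝ) * ε))) := by
  classical
  have hn' : (0:ℝ) < n := by exact_mod_cast hn
  set ι := {k : X → Y → Fin (n+1) // (fun x y => ((k x y : ℕ) : ℝ) / n) ∈ W1 P e E} with hι
  set Wk : ι → X → Y → ℝ := fun i x y => ((i.1 x y : ℕ) : ℝ) / n with hWk
  have hWc : ∀ i, IsChannel (Wk i) := fun i => i.2.1
  have hWm : ∀ i, IsChannel (Wmix η (Wk i)) := fun i => Wmix_channel (hWc i) h0 h1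
  set N : ℝ := ((n:ℝ) + 1) ^ (Fintype.card X * Fintype.card Y) with hN
  have hcard : (Fintype.card ι : ℝ) ≤ N := by
    have h := Fintype.card_subtype_le
      (fun k : X → Y → Fin (n+1) => (fun x y => ((k x y : ℕ) : ℝ) / n) ∈ W1 P e E)
    have h2 : Fintype.card (X → Y → Fin (n+1)) = (n+1) ^ (Fintype.card X * Fintype.card Y) := by
      simp only [Fintype.card_fun, Fintype.card_fin]
      rw [← pow_mul, mul_comm]
    rw [h2] at h
    rw [hN]; exact_mod_cast h
  set K := ⌊(2:ℝ) ^ ((n:ℝ) * (I - φm - 3 * ε))⌋₊ + 1 with hK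
  set M := ⌊(2:ℝ) ^ ((n:ℝ) * (φm + 6 * ε))⌋₊ + 1 with hM
  have hfK : (K:ℝ) - 1 ≤ (2:ℝ) ^ ((n:ℝ) * (I - φm - 3 * ε)) := by
    rw [hK]; push_cast
    rw [add_sub_cancel_right]
    exact Nat.floor_le (by positivity)
  have hfK0 : 0 ≤ (K:ℝ) - 1 := by rw [hK]; push_cast; simp
  have hfK2 : (2:ℝ) ^ ((n:ℝ) * (I - φm - 3 * ε)) ≤ K := by
    rw [hK]; push_cast; exact (Nat.lt_floor_add_one _).le
  have hfM2 : (2:ℝ) ^ ((n:ℝ) * (φm + 6 * ε)) ≤ M := by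
    rw [hM]; push_cast; exact (Nat.lt_floor_add_one _).le
  have hfM : (M:ℝ) ≤ (2:ℝ) ^ ((n:ℝ) * (φm + 6 * ε)) + 1 := by
    rw [hM]; push_cast
    linarith [Nat.floor_le (show 0 ≤ (2:ℝ) ^ ((n:ℝ) * (φm + 6 * ε)) by positivity)]
  have hM0 : 0 < M := Nat.succ_pos _
  have hK0 : 0 < K := Nat.succ_pos _
  clear_value M K
  have hfact : ∀ i us xs ys, iid (pU P V) n us * (∏ t, rr P V (us t) (xs t)) * iid P n xs *
      memoryless (Wk i) n xs ys = ∏ t, P (xs t) * V (xs t) (us t) * Wk i (xs t) (ys t) := by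
    intro i us xs ys
    unfold iid memoryless
    rw [← Finset.prod_mul_distrib, ← Finset.prod_mul_distrib, ← Finset.prod_mul_distrib]
    exact Finset.prod_congr rfl fun t _ => by rw [pU_rr hP hV]
  obtain ⟨enc, henc, dec, hdec⟩ := oneshot (U := Fin n → (Y → Xh)) (X := Fin n → X)
    (Y := Fin n → Y) (ι := ι) (M := M) (K := K) hM0 hK0
    (iid (pU P V) n) (iid_dist (pU_dist hP hV) n) (iid P n) (iid_dist hP n)
    (fun us xs => ∏ t, rr P V (us t) (xs t))
    (fun us xs => Finset.prod_nonneg fun t _ => rr_nonneg hP hV _ _)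
    (fun xs hx => by
      unfold iid
      rw [exp_prod (pU P V) (fun t u => rr P V u (xs t))]
      refine Finset.prod_eq_one fun t _ => rr_sum hP hV _ ?_
      intro h
      exact hx (Finset.prod_eq_zero (Finset.mem_univ t) h))
    (fun i => memoryless (Wk i) n) (fun i => memoryless_channel (hWc i) n)
    (fun us ys => ∃ i, (2:ℝ) ^ ((n:ℝ) * γ) < ∏ t, rho P V (Wmix η (Wk i)) (us t) (ys t))
    (fun xs ys us => D + δ < dseq d n xs (fun t => us t (ys t)))
    (e3 + e2) (Fintype.card ι * (2:ℝ) ^ (-((n:ℝ) * γ))) e1 ((2:ℝ) ^ (-((n:ℝ) * ε)))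
    ((2:ℝ) ^ ((n : ℝ) * (I + ε)))
    (fun ys => false_bound hP hV (fun i => Wmix η (Wk i))
      (fun i u y => rho_nonneg hP hV (hWm i) u y)
      (fun i y => by
        have hc : (0:ℝ) < Fintype.card Y := by exact_mod_cast Fintype.card_pos
        exact (lt_of_lt_of_le (by positivity) (qm_bds hP (hWc i) h0 h1 y).1).ne') γ n ys)
    (fun i => by
      refine le_trans ?_ (add_le_add (hm (Wk i) (hWc i) ?_) (hd (Wk i) (hWc i) (hVd _ i.2)))
      · simp only [← Finset.sum_add_distrib]
        refine Finset.sum_le_sum fun us _ => Finset.sum_le_sum fun xs _ =>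
          Finset.sum_le_sum fun ys _ => ?_
        rw [hfact, ← mul_add]
        refine mul_le_mul_of_nonneg_left ?_ (Finset.prod_nonneg fun t _ =>
          mul_nonneg (mul_nonneg (hP.1 _) ((hV _).1 _)) ((hWc i _).1 _))
        refine (ind_or _ _).trans (add_le_add (ind_mono ?_) le_rfl)
        exact fun h h' => h ⟨i, h'⟩
      · have := hφ (Wk i) i.2
        unfold phi at this
        rw [hη]
        rw [← hI] at this
        linarith)
    hz (by positivity) (by positivity) (by
      have h2 : (0:ℝ) < 2 := by norm_num
      calc (2:ℝ) ^ ((n : ℝ) * (I + ε)) = ((2:ℝ) ^ (-((n:ℝ) * ε))) ^ 2 *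
            ((2:ℝ) ^ ((n:ℝ) * (φm + 6 * ε)) * (2:ℝ) ^ ((n:ℝ) * (I - φm - 3 * ε))) := by
            rw [pow_two, ← Real.rpow_add h2, ← Real.rpow_add h2, ← Real.rpow_add h2]
            congr 1; ring
        _ ≤ _ := by gcongr)
  refine ⟨⟨M, hM0, enc, henc, fun m ys t => dec m ys t (ys t)⟩, hfM, ?_⟩
  intro W hW hT
  have hle : ∀ x y, W x y ≤ 1 := fun x y => by
    rw [← (hW.1 x).2]
    exact Finset.single_le_sum (fun y _ => (hW.1 x).1 y) (Finset.mem_univ y)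
  choose k hk using hT
  have hkn : ∀ x y, k x y < n + 1 := fun x y => by
    have := hle x y
    rw [hk, div_le_one hn'] at this
    exact Nat.lt_succ_of_le (by exact_mod_cast this)
  have hWeq : (fun x y => (((⟨k x y, hkn x y⟩ : Fin (n+1)) : ℕ) : ℝ) / n) = W := by
    funext x y; exact (hk x y).symm
  have hi := hdec ⟨fun x y => ⟨k x y, hkn x y⟩, by rw [hWeq]; exact hW⟩
  have hWi : Wk ⟨fun x y => ⟨k x y, hkn x y⟩, by rw [hWeq]; exact hW⟩ = W := hWeq
  rw [hWi] at hi
  unfold Code.excessProb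
  dsimp only
  refine le_trans hi ?_
  have hb : ((K:ℝ) - 1) * (Fintype.card ι * (2:ℝ) ^ (-((n:ℝ) * γ))) ≤
      N * (2:ℝ) ^ (-((n:ℝ) * ε)) := by
    calc _ ≤ (2:ℝ) ^ ((n:ℝ) * (I - φm - 3 * ε)) * (N * (2:ℝ) ^ (-((n:ℝ) * γ))) := by gcongr
      _ = N * ((2:ℝ) ^ ((n:ℝ) * (I - φm - 3 * ε)) * (2:ℝ) ^ (-((n:ℝ) * γ))) := by ring
      _ = _ := by
        rw [← Real.rpow_add (by norm_num)]
        congr 2; rw [hγ]; ring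
  have hN0 : 0 ≤ N := by positivity
  gcongr


lemma asym (s : ℕ) (μ0 : ℝ) (h : 0 < μ0) : ∃ n0 : ℕ, ∀ n ≥ n0,
    5 * ((n:ℝ) + 1) ^ s * Real.exp (-(n * μ0)) ≤ 1 := by
  have hr : |Real.exp (-μ0)| < 1 := by
    rw [abs_of_pos (Real.exp_pos _)]; rw [← Real.exp_zero]; exact Real.exp_lt_exp.2 (by linarith)
  have ht := tendsto_pow_const_mul_const_pow_of_abs_lt_one s hr
  have ht2 := (Filter.tendsto_add_atTop_iff_nat 1).2 ht
  have hpos : (0:ℝ) < Real.exp (-μ0) / 5 := by positivity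
  obtain ⟨n0, hn0⟩ := Filter.eventually_atTop.1 (ht2.eventually (gt_mem_nhds hpos))
  refine ⟨n0, fun n hn => ?_⟩
  have := hn0 n hn
  push_cast at this
  rw [pow_succ, ← Real.exp_nat_mul, ← mul_assoc] at this
  have he := Real.exp_pos (-μ0)
  rw [show -((n:ℝ) * μ0) = n * -μ0 by ring]
  have h3 : ((n:ℝ) + 1) ^ s * Real.exp (n * -μ0) < 1 / 5 := by
    by_contra hc
    have := mul_le_mul_of_nonneg_right (not_lt.1 hc) he.le
    linarith
  linarith

lemma code_err {X Y Xh : Type*} [Fintype X] [Fintype Y] [Fintype Xh] [DecidableEq Y]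
    [Nonempty X] [Nonempty Y] [Nonempty Xh]
    (P : X → ℝ) (hP : IsDist P)
    (e : X → Y → ℝ) (heZ : ∀ x, ∃ y, e x y = 0)
    (d : X → Xh → ℝ)
    (D E : ℝ) (hE : 0 ≤ E)
    (V : X → (Y → Xh) → ℝ) (hV : V ∈ Vrob P e d E D)
    (δ : ℝ) (hδ : 0 < δ) :
    ∃ μ > (0:ℝ), ∃ n0 : ℕ, ∀ n ≥ n0, ∃ C : Code X Y Xh n,
      Real.logb 2 ((C.M : ℝ)) / (n : ℝ) ≤
        sSup ((fun W => phi P V W) '' W1 P e E) + 2 * δ ∧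
      ∀ W : X → Y → ℝ, W ∈ W1 P e E → isCondType n W →
        C.excessProb P d (memoryless W n) (D + δ) ≤ (2:ℝ) ^ (-(μ * (n : ℝ))) := by
  classical
  obtain ⟨hVc, hVd⟩ := hV
  set φm := sSup ((fun W => phi P V W) '' W1 P e E) with hφm
  obtain ⟨I, hI⟩ : ∃ I, I = mutInf (fun p : (Y → Xh) × X => P p.2 * V p.2 p.1) := ⟨_, rfl⟩
  have hbdd : BddAbove ((fun W => phi P V W) '' W1 P e E) := by
    refine ⟨I, ?_⟩
    rintro _ ⟨W, hW, rfl⟩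
    have : 0 ≤ mutInf (fun p : (Y → Xh) × Y => ∑ x, P x * V x p.1 * W x p.2) := by
      refine mutInf_nonneg _ ⟨fun p => Finset.sum_nonneg fun x _ =>
        mul_nonneg (mul_nonneg (hP.1 x) ((hVc x).1 _)) ((hW.1 x).1 _), ?_⟩
      rw [Fintype.sum_prod_type]
      simp only [sum_yx hP hVc hW.1, (pU_dist hP hVc).2]
    simp only [phi]
    rw [← hI]; linarith
  have hφ : ∀ W ∈ W1 P e E, phi P V W ≤ φm := fun W hW => le_csSup hbdd ⟨W, hW, rfl⟩
  have hφ0 : 0 ≤ φm := by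
    choose f hf using heZ
    have hW : (fun x y => if y = f x then (1:ℝ) else 0) ∈ W1 P e E := by
      refine ⟨fun x => ⟨fun y => by dsimp only; split_ifs <;> norm_num, by simp⟩, ?_⟩
      unfold eDist
      simp [hf, hE]
    have h1 := hφ _ hW
    have h2 := phi_nonneg_aux hP hVc hW.1
    unfold phi at h1
    linarith only [h1, h2]
  obtain ⟨ε, hε4⟩ : ∃ ε, ε = δ / 4 := ⟨_, rfl⟩
  have hε : 0 < ε := by linarith
  obtain ⟨η, hη⟩ : ∃ η, η = 1 - (2:ℝ) ^ (-ε) := ⟨_, rfl⟩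
  have h2e : (0:ℝ) < (2:ℝ) ^ (-ε) := by positivity
  have h2e1 : (2:ℝ) ^ (-ε) < 1 := Real.rpow_lt_one_of_one_lt_of_neg (by norm_num) (by linarith)
  have h0 : 0 < η := by linarith
  have h1 : η < 1 := by linarith
  have hlog : Real.logb 2 (1 - η) = -ε := by
    rw [hη, sub_sub_cancel, Real.logb_rpow (by norm_num) (by norm_num)]
  obtain ⟨B1, hB1, hz⟩ := zeta_bound hP hVc ε hε
  obtain ⟨B2, hB2, hd⟩ := dist_bound hP d D δ hδ hVc
  obtain ⟨B3, hB3, hm⟩ := miss_bound (Y := Y) hP hVc η ε (I - φm - 2 * ε) h0 h1 hε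
  have hl2 : 0 < Real.log 2 := Real.log_pos (by norm_num)
  obtain ⟨μ0, hμ0, m1, m2, m3, m4⟩ : ∃ μ0 > (0:ℝ), μ0 ≤ ε ^ 2 / (4 * B1 ^ 2) ∧
      μ0 ≤ δ ^ 2 / (4 * B2 ^ 2) ∧ μ0 ≤ ε ^ 2 / (4 * B3 ^ 2) ∧ μ0 ≤ ε * Real.log 2 := by
    refine ⟨min (min (ε ^ 2 / (4 * B1 ^ 2)) (δ ^ 2 / (4 * B2 ^ 2)))
      (min (ε ^ 2 / (4 * B3 ^ 2)) (ε * Real.log 2)), ?_, ?_, ?_, ?_, ?_⟩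
    · exact lt_min (lt_min (by positivity) (by positivity)) (lt_min (by positivity) (by positivity))
    · exact (min_le_left _ _).trans (min_le_left _ _)
    · exact (min_le_left _ _).trans (min_le_right _ _)
    · exact (min_le_right _ _).trans (min_le_left _ _)
    · exact (min_le_right _ _).trans (min_le_right _ _)
  set s := Fintype.card X * Fintype.card Y with hs
  obtain ⟨n1, hn1⟩ := asym (2 * s) (μ0 / 2) (by positivity)
  obtain ⟨n2, hn2⟩ := exists_nat_ge (1 / ε)
  refine ⟨μ0 / (2 * Real.log 2), by positivity, max (max n1 n2) 1, fun n hn => ?_⟩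
  have hn1' := hn1 n (le_trans (le_trans (le_max_left _ _) (le_max_left _ _)) hn)
  have hnn2 : n2 ≤ n := le_trans (le_trans (le_max_right _ _) (le_max_left _ _)) hn
  have hn1le : 1 ≤ n := le_trans (le_max_right _ _) hn
  have hn' : (0:ℝ) < n := by exact_mod_cast hn1le
  have hnε : 1 ≤ n * ε := by
    have : (n2:ℝ) ≤ n := by exact_mod_cast hnn2
    have := hn2.trans this
    rwa [div_le_iff₀ hε] at this
  rw [← hI] at hz
  obtain ⟨C, hCM, hC⟩ := code_n hP e d D E hVc hVd δ φm ε η (I - φm - 2 * ε) I hI rfl h0 h1 hlog hφ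
    n hn1le _ _ _ (Real.exp_pos _).le (Real.exp_pos _).le (Real.exp_pos _).le (hz n)
    (hd n hn1le) (hm n)
  refine ⟨C, ?_, fun W hW hT => (hC W hW hT).trans ?_⟩
  · rw [div_le_iff₀ hn']
    have hge : (1:ℝ) ≤ (2:ℝ) ^ ((n:ℝ) * (φm + 6 * ε)) :=
      Real.one_le_rpow (by norm_num) (by positivity)
    have hM0 : (0:ℝ) < C.M := by exact_mod_cast C.Mpos
    have hle : (C.M : ℝ) ≤ (2:ℝ) ^ ((n:ℝ) * (φm + 6 * ε) + 1) := by
      rw [Real.rpow_add (by norm_num), Real.rpow_one]; linarith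
    have := Real.logb_le_logb_of_le (b := 2) (by norm_num) hM0 hle
    rw [Real.logb_rpow (by norm_num) (by norm_num)] at this
    have hδn : δ = 4 * ε := by linarith
    rw [hδn]
    nlinarith
  · have hx : ∀ a, μ0 ≤ a → Real.exp (-(n * a)) ≤ Real.exp (-(n * μ0)) := fun a ha => by
      apply Real.exp_le_exp.2
      have := mul_le_mul_of_nonneg_left ha hn'.le
      linarith
    have h2x : (2:ℝ) ^ (-((n:ℝ) * ε)) ≤ Real.exp (-(n * μ0)) := by
      rw [Real.rpow_def_of_pos (by norm_num)]
      refine le_trans (le_of_eq ?_) (hx _ m4)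
      congr 1; ring
    have hN1 : (1:ℝ) ≤ ((n:ℝ) + 1) ^ s := one_le_pow₀ (by linarith)
    set N := ((n:ℝ) + 1) ^ s with hN
    have hN2 : ((n:ℝ) + 1) ^ (2 * s) = N * N := by rw [hN, two_mul, pow_add]
    rw [hN2] at hn1'
    have hx1 := hx _ m1
    have hx2 := hx _ m2
    have hx3 := hx _ m3
    have hfin : (2:ℝ) ^ (-(μ0 / (2 * Real.log 2) * (n:ℝ))) = Real.exp (-(n * (μ0 / 2))) := by
      rw [Real.rpow_def_of_pos (by norm_num)]
      congr 1; field_simp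
    have hsq : Real.exp (-(n * μ0)) = Real.exp (-(n * (μ0 / 2))) * Real.exp (-(n * (μ0 / 2))) := by
      rw [← Real.exp_add]; congr 1; ring
    have hxp := Real.exp_pos (-(n * μ0))
    have hyp := Real.exp_pos (-(n * (μ0 / 2)))
    rw [hfin]
    set x := Real.exp (-(n * μ0)) with hxd
    set y := Real.exp (-(n * (μ0 / 2))) with hyd
    have hNx : x ≤ N * x := le_mul_of_one_le_left hxp.le hN1
    calc _ ≤ N * (x + x + N * x + x + x) := by gcongr
      _ ≤ N * (5 * (N * x)) := by gcongr; linarith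
      _ = (5 * (N * N) * y) * y := by rw [hsq]; ring
      _ ≤ 1 * y := by gcongr
      _ = y := one_mul _

/-- **universal code for i.i.d. channels.** For any test channel
`V ∈ 𝒱(E,D)` and any `δ > 0`, there exist codes `(φ_n, ψ_n)` and `μ > 0` such that
`(1/n)log|ℳ_n| ≤ max_{W ∈ 𝒲₁(E)} φ(V,W) + 2δ` and
`Pr{d_n(Xⁿ, ψ_n(φ_n(Xⁿ),Yⁿ)) > D + δ} ≤ 2^{−μn}` for every
`W ∈ 𝒲₁(E) ∩ 𝒫_n(𝒴|𝒳)`, where `Yⁿ` is the output of the i.i.d. channel `W^{×n}` on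
input `Xⁿ`, provided `n` is sufficiently large. -/
theorem universal_code_iid
    {X Y Xh : Type*} [Fintype X] [Fintype Y] [Fintype Xh] [DecidableEq Y]
    [Nonempty X] [Nonempty Y] [Nonempty Xh]
    (P : X → ℝ) (hP : IsDist P)
    (e : X → Y → ℝ) (he0 : ∀ x y, 0 ≤ e x y) (heZ : ∀ x, ∃ y, e x y = 0)
    (d : X → Xh → ℝ) (hd0 : ∀ x xh, 0 ≤ d x xh) (hdZ : ∀ x, ∃ xh, d x xh = 0)
    (D E : ℝ) (hD : 0 ≤ D) (hE : 0 ≤ E)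
    (V : X → (Y → Xh) → ℝ) (hV : V ∈ Vrob P e d E D)
    (δ : ℝ) (hδ : 0 < δ) :
    ∃ μ > (0:ℝ), ∃ n0 : ℕ, ∃ C : ∀ n, Code X Y Xh n, ∀ n ≥ n0,
      Real.logb 2 (((C n).M : ℝ)) / (n : ℝ) ≤
        sSup ((fun W => phi P V W) '' W1 P e E) + 2 * δ ∧
      ∀ W : X → Y → ℝ, W ∈ W1 P e E → isCondType n W →
        (C n).excessProb P d (memoryless W n) (D + δ) ≤ (2:ℝ) ^ (-(μ * (n : ℝ))) := by
  obtain ⟨μ, hμ, n0, h⟩ := code_err P hP e heZ d D E hE V hV δ hδ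
  classical
  have hdef : ∀ n : ℕ, ∃ C : Code X Y Xh n, n0 ≤ n →
      Real.logb 2 ((C.M : ℝ)) / (n : ℝ) ≤
        sSup ((fun W => phi P V W) '' W1 P e E) + 2 * δ ∧
      ∀ W : X → Y → ℝ, W ∈ W1 P e E → isCondType n W →
        C.excessProb P d (memoryless W n) (D + δ) ≤ (2:ℝ) ^ (-(μ * (n : ℝ))) := by
    intro n
    by_cases hn : n0 ≤ n
    · obtain ⟨C, hC⟩ := h n hn
      exact ⟨C, fun _ => hC⟩
    · exact ⟨⟨1, one_pos, fun _ _ => 1, fun _ => ⟨fun _ => zero_le_one, by simp⟩,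
        fun _ _ _ => Classical.arbitrary Xh⟩, fun h' => absurd h' hn⟩
  choose C hC using hdef
  exact ⟨μ, hμ, n0, C, fun n hn => hC n hn⟩

end UWZ
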